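/- arXiv:0904.0465 — 3 statements merged into one kernel-verified Lean document; each statement's English description precedes it below -/
import Mathlib

section
/- Let n > 2 be an integer. There exists δ₀ > 0 (depending only on n) such that for any fixed δ ∈ (0, δ₀) there exist R₀ = R₀(δ) > 0 and a constant C = C(n, R₀, δ) with the following property: for every λ > n, every R < R₀, and every smooth function u : ℝⁿ → ℝ compactly supported in B_R that vanishes to infinite order at the origin, one has ‖ r̂^{−λ} u ‖_{L²(B_R)} ≤ (C/λ) ‖ r̂^{−λ} Y(u) ‖_{L²(B_R)}, where r̂(x) = |x|(1 − |x|^δ) and Y(u)(x) = ⟨x, ∇u(x)⟩ is the derivative of u along the radial vector field r∂_r. -/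
open MeasureTheory Metric
open scoped ENNReal

/-- The weight `r̂(x) = |x| (1 - |x|^δ)`. -/
noncomputable def rhat {n : ℕ} (δ : ℝ) (x : EuclideanSpace ℝ (Fin n)) : ℝ :=
  ‖x‖ * (1 - ‖x‖ ^ δ)

section Carleman

open Filter Set Asymptotics
open scoped Topology

/-- Integration in polar coordinates for the lower Lebesgue integral. -/
theorem lintegral_eq_lintegral_toSphere_lintegral_Ioi {E : Type*} [NormedAddCommGroup E]
    [NormedSpace ℝ E] [Nontrivial E] [FiniteDimensional ℝ E] [MeasurableSpace E] [BorelSpace E]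
    (μ : Measure E) [μ.IsAddHaarMeasure] {f : E → ℝ≥0∞} (hf : Measurable f) :
    ∫⁻ x, f x ∂μ = ∫⁻ ω : sphere (0 : E) 1, (∫⁻ r in Ioi (0 : ℝ),
      ENNReal.ofReal (r ^ (Module.finrank ℝ E - 1)) * f (r • (ω : E))) ∂μ.toSphere := by
  have hF : Measurable fun p : sphere (0 : E) 1 × Ioi (0 : ℝ) ↦ f ((p.2 : ℝ) • (p.1 : E)) :=
    hf.comp (by fun_prop)
  have hdens : Measurable fun r : Ioi (0 : ℝ) ↦
      ENNReal.ofReal ((r : ℝ) ^ (Module.finrank ℝ E - 1)) := by fun_prop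
  calc ∫⁻ x, f x ∂μ = ∫⁻ x : ({0}ᶜ : Set E), f x ∂(μ.comap (↑)) := by
        rw [lintegral_subtype_comap (measurableSet_singleton _).compl, restrict_compl_singleton]
    _ = ∫⁻ p : sphere (0 : E) 1 × Ioi (0 : ℝ), f ((p.2 : ℝ) • (p.1 : E))
          ∂(μ.toSphere.prod (Measure.volumeIoiPow (Module.finrank ℝ E - 1))) := by
        rw [← μ.measurePreserving_homeomorphUnitSphereProd.lintegral_comp hF]
        refine lintegral_congr fun x ↦ ?_
        have hx : ‖(x : E)‖ ≠ 0 := norm_ne_zero_iff.2 x.2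
        simp [smul_smul, hx]
    _ = _ := by
        rw [lintegral_prod _ hF.aemeasurable]
        refine lintegral_congr fun ω ↦ ?_
        rw [Measure.volumeIoiPow, lintegral_withDensity_eq_lintegral_mul _ hdens (by fun_prop)]
        exact lintegral_subtype_comap measurableSet_Ioi
          (fun r ↦ ENNReal.ofReal (r ^ (Module.finrank ℝ E - 1)) * f (r • (ω : E)))

/-- A smooth function vanishing to infinite order at the origin is `O(‖x‖ ^ N)` for every `N`. -/
theorem isBigO_norm_pow_of_iteratedFDeriv_eq_zero.{v} {E : Type v} [NormedAddCommGroup E]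
    [NormedSpace ℝ E] (N : ℕ) {F : Type v} [NormedAddCommGroup F] [NormedSpace ℝ F] {f : E → F}
    (hf : ContDiff ℝ (⊤ : ℕ∞) f) (hf₀ : ∀ k, iteratedFDeriv ℝ k f 0 = 0) :
    f =O[𝓝 0] fun x ↦ ‖x‖ ^ N := by
  have hf0 : f 0 = 0 := by simpa using congrArg (fun m ↦ m 0) (hf₀ 0)
  induction N generalizing F with
  | zero => simpa using hf.continuous.continuousAt.isBigO_one ℝ
  | succ N ih =>
    have hf' : ContDiff ℝ (⊤ : ℕ∞) (fderiv ℝ f) := hf.fderiv_right le_rfl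
    have hf'₀ : ∀ k, iteratedFDeriv ℝ k (fderiv ℝ f) 0 = 0 := fun k ↦ by
      rw [← norm_eq_zero, norm_iteratedFDeriv_fderiv, hf₀, norm_zero]
    have hf'0 : fderiv ℝ f 0 = 0 := by simpa using congrArg (fun m ↦ m 0) (hf'₀ 0)
    obtain ⟨C, hC⟩ := (ih hf' hf'₀ hf'0).bound
    obtain ⟨ε, hε, hball⟩ := Metric.eventually_nhds_iff_ball.1 hC
    refine IsBigO.of_bound C ?_
    filter_upwards [ball_mem_nhds (0 : E) hε] with x hx
    have hC0 : 0 ≤ C * ‖x‖ ^ N := by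
      simpa using (norm_nonneg _).trans (hball x hx)
    have key := Convex.norm_image_sub_le_of_norm_fderiv_le (𝕜 := ℝ) (f := f)
      (s := segment ℝ 0 x) (C := C * ‖x‖ ^ N)
      (fun y _ ↦ hf.differentiable (by simp) y) (fun y hy ↦ ?_) (convex_segment 0 x)
      (left_mem_segment ℝ 0 x) (right_mem_segment ℝ 0 x)
    · simpa [hf0, pow_succ, mul_assoc] using key
    · have hyx : ‖y‖ ≤ ‖x‖ := by
        obtain ⟨t, ht, rfl⟩ := (segment_eq_image_lineMap ℝ 0 x ▸ hy :)
        simpa [AffineMap.lineMap_apply, norm_smul, abs_of_nonneg ht.1] using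
          mul_le_mul_of_nonneg_right ht.2 (norm_nonneg x)
      have hyb : y ∈ ball (0 : E) ε := by
        rw [mem_ball_zero_iff] at hx ⊢; exact hyx.trans_lt hx
      have h := hball y hyb
      rw [norm_pow, norm_norm] at h
      rcases eq_or_ne (‖x‖ ^ N) 0 with h0 | h0
      · have : ‖y‖ ^ N = 0 := le_antisymm (h0 ▸ by gcongr) (by positivity)
        simpa [this, h0] using h
      · have hCpos : 0 ≤ C := nonneg_of_mul_nonneg_left hC0 (by positivity)
        exact h.trans (by gcongr)

/-- One-dimensional Carleman inequality on `(ε, R]` with the boundary term at `ε`. -/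
theorem lintegral_pow_mul_sq_le_add {m : ℕ} {l ε R : ℝ} (hl : (m + 1 : ℝ) < l) (hε : 0 < ε)
    (hεR : ε ≤ R) {a W Z : ℝ → ℝ} (ha : ∀ r ∈ Ioo 0 R, 3 / 4 ≤ a r)
    (hWc : ContinuousOn W (Ioc 0 R)) (hZ : ContinuousOn Z (Ioc 0 R))
    (hW : ∀ r ∈ Ioo 0 R, HasDerivAt W ((-l * a r * W r + Z r) / r) r) (hWR : W R = 0) :
    ∫⁻ r in Ioc ε R, ENNReal.ofReal (r ^ m * W r ^ 2) ≤
      ENNReal.ofReal (4 / l * (ε ^ (m + 1) * W ε ^ 2)) +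
      ENNReal.ofReal ((4 / l) ^ 2) * ∫⁻ r in Ioc ε R, ENNReal.ofReal (r ^ m * Z r ^ 2) := by
  have hl0 : 0 < l := lt_trans (by positivity) hl
  have hsub : Icc ε R ⊆ Ioc 0 R := fun r hr ↦ ⟨hε.trans_le hr.1, hr.2⟩
  have hWc' := hWc.mono hsub
  have hZc' := hZ.mono hsub
  have hA : ContinuousOn (fun r ↦ r ^ m * W r ^ 2) (Icc ε R) := by fun_prop
  have hB : ContinuousOn (fun r ↦ r ^ m * Z r ^ 2) (Icc ε R) := by fun_prop
  have hG : ContinuousOn (fun r ↦ r ^ (m + 1) * W r ^ 2) (Icc ε R) := by fun_prop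
  have key := intervalIntegral.sub_le_integral_of_hasDeriv_right_of_le hεR hG
    (g' := fun r ↦ r ^ m * ((m + 1) * W r ^ 2 + 2 * W r * (-l * a r * W r + Z r)))
    (φ := fun r ↦ 4 / l * (r ^ m * Z r ^ 2) - l / 4 * (r ^ m * W r ^ 2)) ?_
    (ContinuousOn.integrableOn_Icc (by fun_prop)) ?_
  · have hAi' : IntervalIntegrable (fun r ↦ r ^ m * W r ^ 2) volume ε R :=
      hA.intervalIntegrable_of_Icc hεR
    have hBi' : IntervalIntegrable (fun r ↦ r ^ m * Z r ^ 2) volume ε R :=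
      hB.intervalIntegrable_of_Icc hεR
    rw [intervalIntegral.integral_sub (hBi'.const_mul _) (hAi'.const_mul _),
      intervalIntegral.integral_const_mul, intervalIntegral.integral_const_mul, hWR,
      intervalIntegral.integral_of_le hεR, intervalIntegral.integral_of_le hεR] at key
    have hnn : ∀ V : ℝ → ℝ, 0 ≤ᵐ[volume.restrict (Ioc ε R)] fun r ↦ r ^ m * V r ^ 2 := fun V ↦ by
      filter_upwards [ae_restrict_mem measurableSet_Ioc] with r hr
      have : 0 < r := hε.trans hr.1
      simp only [Pi.zero_apply]
      positivity
    rw [← ofReal_integral_eq_lintegral_ofReal hAi'.1 (hnn W),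
      ← ofReal_integral_eq_lintegral_ofReal hBi'.1 (hnn Z), ← ENNReal.ofReal_mul (by positivity),
      ← ENNReal.ofReal_add (by positivity)
        (mul_nonneg (by positivity) (integral_nonneg_of_ae (hnn Z)))]
    refine ENNReal.ofReal_le_ofReal ?_
    set IA := ∫ r in Ioc ε R, r ^ m * W r ^ 2
    set IB := ∫ r in Ioc ε R, r ^ m * Z r ^ 2
    have h1 : l / 4 * IA ≤ ε ^ (m + 1) * W ε ^ 2 + 4 / l * IB := by linarith
    calc IA = 4 / l * (l / 4 * IA) := by field_simp
      _ ≤ 4 / l * (ε ^ (m + 1) * W ε ^ 2 + 4 / l * IB) := by gcongr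
      _ = _ := by ring
  · intro r hr
    have hr0 : 0 < r := hε.trans hr.1
    have h := (hasDerivAt_pow (m + 1) r).mul ((hW r ⟨hr0, hr.2⟩).pow 2)
    refine (h.congr_deriv ?_).hasDerivWithinAt
    simp
    field_simp
    ring
  · intro r hr
    have hr0 : 0 < r := hε.trans hr.1
    have har := ha r ⟨hr0, hr.2⟩
    have h1 : (m + 1) * W r ^ 2 + 2 * W r * (-l * a r * W r + Z r) ≤
        4 / l * Z r ^ 2 - l / 4 * W r ^ 2 := by
      have h2 : 0 ≤ (l - (m + 1)) * W r ^ 2 := mul_nonneg (by linarith) (sq_nonneg _)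
      have h3 : 0 ≤ (a r - 3 / 4) * (l * W r ^ 2) := mul_nonneg (by linarith) (by positivity)
      have h4 : 4 / l * Z r ^ 2 - 2 * W r * Z r + l / 4 * W r ^ 2
          = l⁻¹ * (2 * Z r - l / 2 * W r) ^ 2 := by field_simp; ring
      have h5 : 0 ≤ l⁻¹ * (2 * Z r - l / 2 * W r) ^ 2 := by positivity
      nlinarith
    calc _ ≤ r ^ m * (4 / l * Z r ^ 2 - l / 4 * W r ^ 2) := by gcongr
      _ = _ := by ring

/-- One-dimensional Carleman inequality on `(0, R]`, for a function whose boundary term at `0`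
vanishes. -/
theorem lintegral_pow_mul_sq_le {m : ℕ} {l R : ℝ} (hl : (m + 1 : ℝ) < l)
    (hR : 0 < R) {a W Z : ℝ → ℝ} (ha : ∀ r ∈ Ioo 0 R, 3 / 4 ≤ a r)
    (hWc : ContinuousOn W (Ioc 0 R)) (hZ : ContinuousOn Z (Ioc 0 R))
    (hW : ∀ r ∈ Ioo 0 R, HasDerivAt W ((-l * a r * W r + Z r) / r) r) (hWR : W R = 0)
    (hW0 : Tendsto (fun r ↦ r ^ (m + 1) * W r ^ 2) (𝓝[>] 0) (𝓝 0)) :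
    ∫⁻ r in Ioc 0 R, ENNReal.ofReal (r ^ m * W r ^ 2) ≤
      ENNReal.ofReal ((4 / l) ^ 2) * ∫⁻ r in Ioc 0 R, ENNReal.ofReal (r ^ m * Z r ^ 2) := by
  set I := ENNReal.ofReal ((4 / l) ^ 2) * ∫⁻ r in Ioc 0 R, ENNReal.ofReal (r ^ m * Z r ^ 2)
  have hε : ∀ ε > 0, ∫⁻ r in Ioc ε R, ENNReal.ofReal (r ^ m * W r ^ 2) ≤ I := by
    intro ε hε
    have hlim : Tendsto (fun t ↦ ENNReal.ofReal (4 / l * (t ^ (m + 1) * W t ^ 2)) + I)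
        (𝓝[>] 0) (𝓝 I) := by
      simpa using (ENNReal.tendsto_ofReal (hW0.const_mul (4 / l))).add_const I
    refine ge_of_tendsto hlim ?_
    filter_upwards [Ioo_mem_nhdsGT (lt_min hε hR)] with t ht
    have htε : t ≤ ε := ht.2.le.trans (min_le_left _ _)
    calc _ ≤ ∫⁻ r in Ioc t R, ENNReal.ofReal (r ^ m * W r ^ 2) :=
          lintegral_mono_set (Ioc_subset_Ioc_left htε)
      _ ≤ _ := lintegral_pow_mul_sq_le_add hl ht.1 (ht.2.le.trans (min_le_right _ _)) ha hWc hZ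
          hW hWR
      _ ≤ _ := add_le_add le_rfl
          (mul_le_mul' le_rfl (lintegral_mono_set (Ioc_subset_Ioc_left ht.1.le)))
  have hU : Ioc 0 R = ⋃ k : ℕ, Ioc (1 / ((k : ℝ) + 1)) R := by
    ext r
    simp only [mem_iUnion, mem_Ioc]
    refine ⟨fun h ↦ ?_, fun ⟨k, h⟩ ↦ ⟨lt_trans (by positivity) h.1, h.2⟩⟩
    obtain ⟨k, hk⟩ := exists_nat_one_div_lt h.1
    exact ⟨k, hk, h.2⟩
  rw [hU, setLIntegral_iUnion_of_directed]
  · exact iSup_le fun k ↦ hε _ (by positivity)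
  · exact Monotone.directed_le (f := fun k : ℕ ↦ Ioc (1 / ((k : ℝ) + 1)) R) fun j k hjk ↦
      Ioc_subset_Ioc_left (by gcongr)

/-- The Carleman inequality along a ray, with the weight `(r (1 - r ^ δ)) ^ (-l)`. -/
theorem lintegral_Ioi_pow_mul_rhat_sq_le {m N : ℕ} {δ l R : ℝ} (hδ : 0 < δ) (hδ1 : δ < 1)
    (hl : (m + 1 : ℝ) < l) (hN : l ≤ N) (hR : 0 < R) (hRδ : R ^ δ ≤ 1 / 5) {f f' : ℝ → ℝ}
    (hf : ∀ r, HasDerivAt f (f' r) r) (hf' : Continuous f') (hfR : ∀ r, R ≤ r → f r = 0)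
    (hf0 : f =O[𝓝 0] fun r ↦ r ^ N) :
    ∫⁻ r in Ioi (0 : ℝ), ENNReal.ofReal (r ^ m) *
        ‖(r * (1 - r ^ δ)) ^ (-l) * f r‖ₑ ^ 2 ≤
      ENNReal.ofReal ((4 / l) ^ 2) * ∫⁻ r in Ioi (0 : ℝ), ENNReal.ofReal (r ^ m) *
        ‖(r * (1 - r ^ δ)) ^ (-l) * (r * f' r)‖ₑ ^ 2 := by
  have hl0 : 0 < l := lt_trans (by positivity) hl
  have hfc : Continuous f := continuous_iff_continuousAt.2 fun r ↦ (hf r).continuousAt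
  have hrδ : ∀ r ∈ Ioc 0 R, r ^ δ ≤ 1 / 5 := fun r hr ↦
    (Real.rpow_le_rpow hr.1.le hr.2 hδ.le).trans hRδ
  have hρ : ∀ r ∈ Ioc 0 R, r * (4 / 5) ≤ r * (1 - r ^ δ) := fun r hr ↦
    mul_le_mul_of_nonneg_left (by linarith [hrδ r hr]) hr.1.le
  have hρ0 : ∀ r ∈ Ioc 0 R, 0 < r * (1 - r ^ δ) := fun r hr ↦
    (mul_pos hr.1 (by norm_num)).trans_le (hρ r hr)
  set V : ℝ → ℝ := fun r ↦ (r * (1 - r ^ δ)) ^ (-l)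
  have hVc : ContinuousOn V (Ioc 0 R) := by
    refine ContinuousOn.rpow_const ?_ fun r hr ↦ Or.inl (hρ0 r hr).ne'
    exact continuousOn_id.mul (continuousOn_const.sub
      (continuousOn_id.rpow_const fun r hr ↦ Or.inl hr.1.ne'))
  have hsq : ∀ (g : ℝ → ℝ) (r : ℝ), 0 < r →
      ENNReal.ofReal (r ^ m) * ‖g r‖ₑ ^ 2 = ENNReal.ofReal (r ^ m * g r ^ 2) := fun g r hr ↦ by
    rw [ENNReal.ofReal_mul (by positivity), Real.enorm_eq_ofReal_abs,
      ← ENNReal.ofReal_pow (abs_nonneg _), sq_abs]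
  have hsetsq : ∀ g : ℝ → ℝ, ∫⁻ r in Ioc 0 R, ENNReal.ofReal (r ^ m) * ‖g r‖ₑ ^ 2 =
      ∫⁻ r in Ioc 0 R, ENNReal.ofReal (r ^ m * g r ^ 2) := fun g ↦
    setLIntegral_congr_fun measurableSet_Ioc fun r hr ↦ hsq g r hr.1
  have hleft : ∫⁻ r in Ioi (0 : ℝ), ENNReal.ofReal (r ^ m) * ‖V r * f r‖ₑ ^ 2 =
      ∫⁻ r in Ioc 0 R, ENNReal.ofReal (r ^ m) * ‖V r * f r‖ₑ ^ 2 := by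
    rw [← Ioc_union_Ioi_eq_Ioi hR.le, lintegral_union measurableSet_Ioi Ioc_disjoint_Ioi_same,
      setLIntegral_congr_fun measurableSet_Ioi fun r hr ↦ by rw [hfR r (le_of_lt hr)]]
    simp
  have main := lintegral_pow_mul_sq_le (m := m) hl hR
    (a := fun r ↦ (1 - r ^ δ - δ * r ^ δ) / (1 - r ^ δ))
    (W := fun r ↦ V r * f r) (Z := fun r ↦ V r * (r * f' r)) ?_ (hVc.mul hfc.continuousOn)
    (hVc.mul (continuous_id.mul hf').continuousOn) ?_ (by simp [hfR R le_rfl]) ?_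
  · rw [hleft, hsetsq fun r ↦ V r * f r]
    refine main.trans ?_
    rw [← hsetsq fun r ↦ V r * (r * f' r)]
    exact mul_le_mul' le_rfl (lintegral_mono_set Ioc_subset_Ioi_self)
  · intro r hr
    have h := hrδ r ⟨hr.1, hr.2.le⟩
    have h0 : 0 < r ^ δ := Real.rpow_pos_of_pos hr.1 δ
    rw [le_div_iff₀ (by linarith)]
    nlinarith
  · intro r hr
    have hr' : r ∈ Ioc 0 R := ⟨hr.1, hr.2.le⟩
    have h := hrδ r hr'
    have hr0 : r ≠ 0 := hr.1.ne'
    have h1 : (1 - r ^ δ) ≠ 0 := by linarith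
    have hd := (((hasDerivAt_id r).mul ((hasDerivAt_const r (1 : ℝ)).sub
      (Real.hasDerivAt_rpow_const (p := δ) (Or.inl hr0)))).rpow_const (p := -l)
      (Or.inl (hρ0 r hr').ne')).mul (hf r)
    refine hd.congr_deriv ?_
    have e1 : r ^ (δ - 1) = r ^ δ / r := by rw [Real.rpow_sub hr.1, Real.rpow_one]
    have e2 : (r * (1 - r ^ δ)) ^ (-l - 1) = V r / (r * (1 - r ^ δ)) := by
      rw [Real.rpow_sub (hρ0 r hr'), Real.rpow_one]
    simp only [id, Pi.mul_apply, Pi.sub_apply, e1, e2]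
    change _ + V r * f' r = _
    field_simp
    ring
  · have hWO : (fun r ↦ V r * f r) =O[𝓝[>] 0] fun _ ↦ (1 : ℝ) := by
      have hVO : V =O[𝓝[>] 0] fun r ↦ r ^ (-l) := by
        refine IsBigO.of_bound ((4 / 5) ^ (-l)) ?_
        filter_upwards [Ioo_mem_nhdsGT hR] with r hr
        have hr' : r ∈ Ioc 0 R := ⟨hr.1, hr.2.le⟩
        rw [Real.norm_of_nonneg (Real.rpow_nonneg (hρ0 r hr').le _),
          Real.norm_of_nonneg (Real.rpow_nonneg hr.1.le _), mul_comm ((4 / 5 : ℝ) ^ (-l)),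
          ← Real.mul_rpow hr.1.le (by norm_num)]
        exact Real.rpow_le_rpow_of_nonpos (mul_pos hr.1 (by norm_num)) (hρ r hr') (by linarith)
      refine (hVO.mul (hf0.mono nhdsWithin_le_nhds)).trans (IsBigO.of_bound 1 ?_)
      filter_upwards [Ioo_mem_nhdsGT (zero_lt_one (α := ℝ))] with r hr
      rw [← Real.rpow_natCast, ← Real.rpow_add hr.1,
        Real.norm_of_nonneg (Real.rpow_nonneg hr.1.le _)]
      simpa using Real.rpow_le_one hr.1.le hr.2.le (by linarith)
    have hp : Tendsto (fun r : ℝ ↦ r ^ (m + 1)) (𝓝[>] 0) (𝓝 0) := by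
      have : Tendsto (fun r : ℝ ↦ r ^ (m + 1)) (𝓝 0) (𝓝 (0 ^ (m + 1))) :=
        (continuous_pow (m + 1)).tendsto 0
      simpa using this.mono_left nhdsWithin_le_nhds
    refine IsBigO.trans_tendsto ?_ hp
    simpa using (isBigO_refl (fun r : ℝ ↦ r ^ (m + 1)) (𝓝[>] 0)).mul (hWO.pow 2)

end Carleman

/-- The ODE-type Carleman estimate (Lemma 2.2): for `n > 2` there is `δ₀ > 0` (depending
only on `n`) such that for any `δ ∈ (0, δ₀)` there are `R₀ = R₀(δ) > 0` and
`C = C(n, R₀, δ) > 0` with: for all `λ > n`, all `R < R₀`, and all smooth `u`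
compactly supported in `B_R` vanishing to infinite order at the origin,
`‖r̂^{-λ} u‖_{L²(B_R)} ≤ (C/λ) ‖r̂^{-λ} Y(u)‖_{L²(B_R)}`,
where `Y(u)(x) = ⟨x, ∇u(x)⟩ = (Du)(x)(x)` is the radial derivative. -/
theorem ode_carleman (n : ℕ) (hn : 2 < n) :
    ∃ δ₀ > (0 : ℝ), ∀ δ : ℝ, 0 < δ → δ < δ₀ →
      ∃ R₀ > (0 : ℝ), ∃ C > (0 : ℝ),
        ∀ lam : ℝ, (n : ℝ) < lam → ∀ R : ℝ, 0 < R → R < R₀ →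
        ∀ u : EuclideanSpace ℝ (Fin n) → ℝ, ContDiff ℝ (⊤ : ℕ∞) u →
          HasCompactSupport u → tsupport u ⊆ ball (0 : EuclideanSpace ℝ (Fin n)) R →
          (∀ k : ℕ, iteratedFDeriv ℝ k u 0 = 0) →
          eLpNorm (fun x => rhat δ x ^ (-lam) * u x) 2
              (volume.restrict (ball (0 : EuclideanSpace ℝ (Fin n)) R))
            ≤ ENNReal.ofReal (C / lam) *
              eLpNorm (fun x => rhat δ x ^ (-lam) * fderiv ℝ u x x) 2
                (volume.restrict (ball (0 : EuclideanSpace ℝ (Fin n)) R)) := by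
  have : NeZero n := ⟨by omega⟩
  refine ⟨1, one_pos, fun δ hδ hδ1 ↦ ⟨(1 / 5) ^ (1 / δ), by positivity, 4, by norm_num, ?_⟩⟩
  intro l hl R hR hR₀ u hu _ hsupp hu0
  have hl0 : 0 < l := lt_of_le_of_lt (Nat.cast_nonneg n) hl
  have hRδ : R ^ δ ≤ 1 / 5 := by
    calc R ^ δ ≤ ((1 / 5 : ℝ) ^ (1 / δ)) ^ δ := by gcongr
      _ = 1 / 5 := by rw [← Real.rpow_mul (by norm_num), one_div_mul_cancel hδ.ne', Real.rpow_one]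
  have hfd : Continuous (fderiv ℝ u) := hu.continuous_fderiv (by simp)
  have hs1 : (fun x ↦ rhat δ x ^ (-l) * u x).support ⊆
      ball (0 : EuclideanSpace ℝ (Fin n)) R := fun x hx ↦
    hsupp (subset_tsupport u (right_ne_zero_of_mul hx))
  have hs2 : (fun x ↦ rhat δ x ^ (-l) * fderiv ℝ u x x).support ⊆
      ball (0 : EuclideanSpace ℝ (Fin n)) R := fun x hx ↦
    hsupp (support_fderiv_subset ℝ fun h ↦ right_ne_zero_of_mul hx (by simp [h]))
  have hrhat : Measurable fun x : EuclideanSpace ℝ (Fin n) ↦ rhat δ x ^ (-l) := by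
    unfold rhat; fun_prop
  have hm1 : Measurable fun x ↦ ‖rhat δ x ^ (-l) * u x‖ₑ ^ 2 :=
    ((hrhat.mul hu.continuous.measurable).enorm).pow_const 2
  have hm2 : Measurable fun x ↦ ‖rhat δ x ^ (-l) * fderiv ℝ u x x‖ₑ ^ 2 :=
    ((hrhat.mul (hfd.clm_apply continuous_id).measurable).enorm).pow_const 2
  rw [eLpNorm_restrict_eq_of_support_subset hs1, eLpNorm_restrict_eq_of_support_subset hs2]
  refine (ENNReal.pow_le_pow_left_iff two_ne_zero).1 ?_
  have hsq : ∀ g : EuclideanSpace ℝ (Fin n) → ℝ, eLpNorm g 2 volume ^ 2 = ∫⁻ x, ‖g x‖ₑ ^ 2 :=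
    fun g ↦ by
      simpa using eLpNorm_nnreal_pow_eq_lintegral (μ := volume) (f := g) (two_ne_zero (α := NNReal))
  rw [mul_pow, hsq, hsq, lintegral_eq_lintegral_toSphere_lintegral_Ioi _ hm1,
    lintegral_eq_lintegral_toSphere_lintegral_Ioi _ hm2,
    ← ENNReal.ofReal_pow (by positivity), ← lintegral_const_mul' _ _ ENNReal.ofReal_ne_top]
  refine lintegral_mono fun ω ↦ ?_
  have hω : ‖(ω : EuclideanSpace ℝ (Fin n))‖ = 1 := by simp
  obtain ⟨N, hN⟩ := exists_nat_ge l
  have key := lintegral_Ioi_pow_mul_rhat_sq_le (m := n - 1) (N := N) hδ hδ1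
    (by rwa [Nat.cast_pred (by omega), sub_add_cancel]) hN hR hRδ
    (f := fun r ↦ u (r • (ω : EuclideanSpace ℝ (Fin n))))
    (f' := fun r ↦ fderiv ℝ u (r • (ω : EuclideanSpace ℝ (Fin n))) ω)
    ?_ ?_ ?_ ?_
  · have hrω : ∀ r ∈ Set.Ioi (0 : ℝ),
        rhat δ (r • (ω : EuclideanSpace ℝ (Fin n))) = r * (1 - r ^ δ) := fun r hr ↦ by
      rw [rhat, norm_smul, hω, mul_one, Real.norm_of_nonneg (le_of_lt hr)]
    simp only [finrank_euclideanSpace, Fintype.card_fin]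
    rw [setLIntegral_congr_fun measurableSet_Ioi fun r hr ↦ by rw [hrω r hr]]
    refine key.trans_eq ?_
    congr 1
    exact setLIntegral_congr_fun measurableSet_Ioi fun r hr ↦ by simp [hrω r hr]
  · intro r
    have h := ((hu.differentiable (by simp)) (r • (ω : EuclideanSpace ℝ (Fin n)))).hasFDerivAt
    simpa [Function.comp_def] using h.comp_hasDerivAt r ((hasDerivAt_id r).smul_const _)
  · exact (hfd.comp (by fun_prop)).clm_apply continuous_const
  · intro r hr
    by_contra h
    have := hsupp (subset_tsupport u h)
    rw [mem_ball_zero_iff, norm_smul, hω, mul_one, Real.norm_of_nonneg (hR.le.trans hr)] at this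
    linarith
  · have ht : Filter.Tendsto (fun r : ℝ ↦ r • (ω : EuclideanSpace ℝ (Fin n))) (nhds 0)
        (nhds 0) := by
      have : Continuous fun r : ℝ ↦ r • (ω : EuclideanSpace ℝ (Fin n)) := by fun_prop
      simpa using this.tendsto 0
    have h := (isBigO_norm_pow_of_iteratedFDeriv_eq_zero N hu hu0).comp_tendsto ht
    refine h.congr_right ?_ |>.of_norm_right
    intro r
    simp [norm_smul]
end

section
/- Let n > 2 be an integer and C ≥ 0. Suppose u and v are smooth real-valued functions defined on an open neighborhood of the origin in ℝⁿ satisfying the differential inequalities |Δu(x)| ≤ C( |u(x)| + |∇u(x)| + |v(x)| ) and |⟨x, ∇v(x)⟩| ≤ C( |v(x)| + |u(x)| + |∇u(x)| ) on that neighborhood, where Δ is the Euclidean Laplacian. If both u and v vanish to infinite order at the origin, then there is an open neighborhood U of the origin on which u ≡ 0 and v ≡ 0. -/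
open MeasureTheory Metric

/-- The Euclidean Laplacian `Δu = ∑ i, ∂²u/∂xᵢ²`. -/
noncomputable def lap {n : ℕ} (u : EuclideanSpace ℝ (Fin n) → ℝ)
    (x : EuclideanSpace ℝ (Fin n)) : ℝ :=
  ∑ i : Fin n,
    iteratedFDeriv ℝ 2 u x ![EuclideanSpace.single i (1 : ℝ), EuclideanSpace.single i (1 : ℝ)]

section

open Asymptotics
open scoped ContDiff Topology InnerProductSpace

section Flat
variable {E F G H : Type} [NormedAddCommGroup E] [NormedSpace ℝ E] [NormedAddCommGroup F]
  [NormedSpace ℝ F] [NormedAddCommGroup G] [NormedSpace ℝ G] [NormedAddCommGroup H]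
  [NormedSpace ℝ H]

/-- A smooth function all of whose derivatives vanish at the origin. -/
structure IsFlat (f : E → F) : Prop where
  smooth : ContDiff ℝ ∞ f
  iteratedFDeriv_eq_zero : ∀ k : ℕ, iteratedFDeriv ℝ k f 0 = 0

theorem IsFlat.apply_zero {f : E → F} (hf : IsFlat f) : f 0 = 0 := by
  have h := hf.iteratedFDeriv_eq_zero 0
  rw [← norm_eq_zero, norm_iteratedFDeriv_zero, norm_eq_zero] at h
  exact h

theorem IsFlat.fderiv {f : E → F} (hf : IsFlat f) : IsFlat (fderiv ℝ f) where
  smooth := hf.smooth.fderiv_right (by simp)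
  iteratedFDeriv_eq_zero k := by
    rw [← norm_eq_zero, norm_iteratedFDeriv_fderiv, hf.iteratedFDeriv_eq_zero, norm_zero]

theorem IsFlat.add {f g : E → F} (hf : IsFlat f) (hg : IsFlat g) :
    IsFlat (fun x => f x + g x) where
  smooth := hf.smooth.add hg.smooth
  iteratedFDeriv_eq_zero k := by
    rw [fun_iteratedFDeriv_add_apply (hf.smooth.of_le (by exact_mod_cast le_top)).contDiffAt
      (hg.smooth.of_le (by exact_mod_cast le_top)).contDiffAt,
      hf.iteratedFDeriv_eq_zero, hg.iteratedFDeriv_eq_zero, add_zero]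

theorem IsFlat.clm_comp {f : E → F} (hf : IsFlat f) (T : F →L[ℝ] G) :
    IsFlat (fun x => T (f x)) where
  smooth := T.contDiff.comp hf.smooth
  iteratedFDeriv_eq_zero k := by
    have := T.iteratedFDeriv_comp_left (x := (0 : E)) hf.smooth.contDiffAt
      (i := k) (by exact_mod_cast le_top)
    exact this.trans (by rw [hf.iteratedFDeriv_eq_zero]; ext; simp)

theorem IsFlat.bilinear (B : F →L[ℝ] G →L[ℝ] H) {f : E → F} {g : E → G} (hf : ContDiff ℝ ∞ f)
    (hg : IsFlat g) : IsFlat (fun x => B (f x) (g x)) where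
  smooth := (B.contDiff.comp hf).clm_apply hg.smooth
  iteratedFDeriv_eq_zero k := by
    have := B.norm_iteratedFDeriv_le_of_bilinear hf hg.smooth 0 (n := k) (by exact_mod_cast le_top)
    rw [← norm_le_zero_iff]
    simpa [hg.iteratedFDeriv_eq_zero] using this

theorem IsFlat.smul_left {c : E → ℝ} {f : E → F} (hc : ContDiff ℝ ∞ c) (hf : IsFlat f) :
    IsFlat (fun x => c x • f x) :=
  hf.bilinear (ContinuousLinearMap.lsmul ℝ ℝ) hc

theorem IsFlat.smul_right {c : E → ℝ} {f : E → F} (hc : IsFlat c) (hf : ContDiff ℝ ∞ f) :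
    IsFlat (fun x => c x • f x) :=
  hc.bilinear (ContinuousLinearMap.lsmul ℝ ℝ : ℝ →L[ℝ] F →L[ℝ] F).flip hf

theorem IsFlat.isBigO (m : ℕ) : ∀ {F : Type} [NormedAddCommGroup F] [NormedSpace ℝ F]
    {f : E → F}, IsFlat f → f =O[𝓝 0] fun x => ‖x‖ ^ m := by
  induction m with
  | zero =>
    intro F _ _ f hf
    simpa using (hf.smooth.continuous.tendsto 0).isBigO_one ℝ
  | succ m ih =>
    intro F _ _ f hf
    obtain ⟨C, hC, h⟩ := (ih hf.fderiv).exists_pos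
    obtain ⟨ε, hε, h⟩ := Metric.eventually_nhds_iff_ball.1 h.bound
    refine IsBigO.of_bound C (Metric.eventually_nhds_iff_ball.2 ⟨ε, hε, fun x hx => ?_⟩)
    have hx' : ‖x‖ < ε := by simpa using hx
    have := (convex_closedBall (0 : E) ‖x‖).norm_image_sub_le_of_norm_fderiv_le (𝕜 := ℝ) (f := f)
      (C := C * ‖x‖ ^ m) (x := 0) (y := x)
      (fun y _ => (hf.smooth.differentiable (by simp)) y) (fun y hy => by
        have hy' : ‖y‖ ≤ ‖x‖ := by simpa using hy
        refine (h y (by simpa using hy'.trans_lt hx')).trans ?_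
        rw [norm_pow, norm_norm]
        gcongr) (by simp) (by simp)
    rw [hf.apply_zero, sub_zero, sub_zero] at this
    rw [norm_pow, norm_norm, pow_succ, ← mul_assoc]
    exact this

end Flat

section
variable {E F : Type} [NormedAddCommGroup E] [InnerProductSpace ℝ E] [NormedAddCommGroup F]
  [NormedSpace ℝ F]

theorem hasFDerivAt_inv_norm_sq_pow (k : ℕ) {x : E} (hx : x ≠ 0) :
    HasFDerivAt (fun y : E => ((‖y‖ ^ 2) ^ k)⁻¹)
      ((-(k * (‖x‖ ^ 2) ^ (k - 1)) / ((‖x‖ ^ 2) ^ k) ^ 2) • (2 • innerSL ℝ x)) x := by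
  have hs : (‖x‖ ^ 2) ^ k ≠ 0 := by positivity
  exact HasDerivAt.comp_hasFDerivAt (f := fun y : E => ‖y‖ ^ 2) (h₂ := fun s : ℝ => (s ^ k)⁻¹) x
    ((hasDerivAt_pow k (‖x‖ ^ 2)).fun_inv hs) (hasStrictFDerivAt_norm_sq x).hasFDerivAt

theorem IsFlat.hasFDerivAt_inv_pow_smul_zero {f : E → F} (hf : IsFlat f) (k : ℕ) :
    HasFDerivAt (fun x => ((‖x‖ ^ 2) ^ k)⁻¹ • f x) (0 : E →L[ℝ] F) 0 := by
  have : (fun x : E => ((‖x‖ ^ 2) ^ k)⁻¹ • f x) =O[𝓝 0] fun x => ‖x - 0‖ ^ 2 := by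
    obtain ⟨C, hC, h⟩ := (hf.isBigO (2 * k + 2)).exists_pos
    refine IsBigO.of_bound C (h.bound.mono fun x hx => ?_)
    rw [norm_smul, norm_inv, norm_pow, norm_pow, norm_norm, sub_zero, norm_pow, norm_norm]
    rcases eq_or_ne x 0 with rfl | hx0
    · simp [hf.apply_zero]
    · have : 0 < ‖x‖ := norm_pos_iff.2 hx0
      rw [norm_pow, norm_norm] at hx
      rw [inv_mul_le_iff₀ (by positivity)]
      exact hx.trans (le_of_eq (by ring))
  exact this.hasFDerivAt (by norm_num)

/-- Dividing a flat function by a power of `‖x‖ ^ 2` leaves it continuously differentiable. -/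
theorem IsFlat.contDiff_inv_pow_smul {f : E → F} (hf : IsFlat f) (k : ℕ) :
    ContDiff ℝ 1 (fun x => ((‖x‖ ^ 2) ^ k)⁻¹ • f x) := by
  have h0 := hf.hasFDerivAt_inv_pow_smul_zero k
  have hoff : ∀ x : E, x ≠ 0 → ContDiffAt ℝ 1 (fun x => ((‖x‖ ^ 2) ^ k)⁻¹ • f x) x := fun x hx =>
    ContDiffAt.smul (ContDiffAt.inv ((contDiff_norm_sq ℝ).pow k).contDiffAt (by positivity))
      (hf.smooth.of_le (by exact_mod_cast le_top)).contDiffAt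
  rw [contDiff_one_iff_fderiv]
  refine ⟨fun x => ?_, continuous_iff_continuousAt.2 fun x => ?_⟩
  · rcases eq_or_ne x 0 with rfl | hx
    · exact h0.differentiableAt
    · exact (hoff x hx).differentiableAt (by simp)
  · rcases eq_or_ne x 0 with rfl | hx
    swap
    · exact ((hoff x hx).fderiv_right (m := 0) (by simp)).continuousAt
    rw [ContinuousAt, h0.fderiv, tendsto_zero_iff_norm_tendsto_zero]
    obtain ⟨C, hC, h⟩ := (hf.isBigO (4 * k)).exists_pos
    obtain ⟨D, hD, h'⟩ := (hf.fderiv.isBigO (2 * k + 1)).exists_pos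
    have hlim : Filter.Tendsto
        (fun x : E => D * ‖x‖ + 2 * k * (‖x‖ ^ 2) ^ (k - 1) * ‖x‖ * C) (𝓝 0) (𝓝 0) :=
      Continuous.tendsto' (by fun_prop) _ _ (by simp)
    refine squeeze_zero' (Filter.Eventually.of_forall fun x => norm_nonneg _) ?_ hlim
    filter_upwards [h.bound, h'.bound] with x hx hx'
    rcases eq_or_ne x 0 with rfl | hx0
    · simp [h0.fderiv]
    have hpos : 0 < ‖x‖ := norm_pos_iff.2 hx0
    rw [norm_pow, norm_norm] at hx hx'
    have hd := (hasFDerivAt_inv_norm_sq_pow k hx0).fun_smul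
      ((hf.smooth.differentiable (by simp)) x).hasFDerivAt
    rw [HasFDerivAt.fderiv hd]
    refine (norm_add_le _ _).trans (add_le_add ?_ ?_)
    · rw [norm_smul, norm_inv, norm_pow, norm_pow, norm_norm, inv_mul_le_iff₀ (by positivity)]
      exact hx'.trans (le_of_eq (by ring))
    · rw [ContinuousLinearMap.norm_smulRight_apply, norm_smul, ← Nat.cast_smul_eq_nsmul ℝ,
        norm_smul, innerSL_apply_norm, norm_div, norm_neg, norm_mul, norm_pow,
        norm_pow, norm_pow, norm_pow, norm_norm, RCLike.norm_natCast]
      calc _ ≤ k * (‖x‖ ^ 2) ^ (k - 1) / ((‖x‖ ^ 2) ^ k) ^ 2 * (2 * ‖x‖) * (C * ‖x‖ ^ (4 * k)) := by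
            gcongr
            all_goals simp
        _ = _ := by
            have : (‖x‖ ^ 2) ^ k ≠ 0 := by positivity
            field_simp
            ring

end

/-- The radial derivative, in logarithmic scale, of the square root of the weight
`s ^ (-(τ + 1)) * exp (2 * τ * s)`, `s = ‖x‖ ^ 2`, divided by it. -/
def logSlope (τ s : ℝ) : ℝ := 2 * τ * s - τ - 1

/-- The coefficient of `u ^ 2` in the radial part of the Carleman vector field. -/
def radialCoeff (τ ν s : ℝ) : ℝ :=
  2 * τ * (1 - 2 * s) * (logSlope τ s ^ 2 + τ ^ 2 * (1 - 2 * s) ^ 2 + ν - 1)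
    + 2 * τ * (ν - (2 * ν + 8) * s) * logSlope τ s + (4 * ν + 16) * τ * s

/-- The derivative of `radialCoeff` in `s`. -/
def radialCoeffDeriv (τ ν s : ℝ) : ℝ :=
  -4 * τ * (logSlope τ s ^ 2 + τ ^ 2 * (1 - 2 * s) ^ 2 + ν - 1)
    + 2 * τ * (1 - 2 * s) * (4 * τ * logSlope τ s - 4 * τ ^ 2 * (1 - 2 * s))
    - 2 * τ * (2 * ν + 8) * logSlope τ s + 2 * τ * (ν - (2 * ν + 8) * s) * (2 * τ)
    + (4 * ν + 16) * τ

/-- The coefficient of `u` in the gradient part of the Carleman vector field. -/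
def gradCoeff (τ ν s : ℝ) : ℝ :=
  4 * τ * (1 - 2 * s) * logSlope τ s + 2 * τ * (ν - (2 * ν + 8) * s)

/-- The derivative of `gradCoeff` in `s`. -/
def gradCoeffDeriv (τ ν s : ℝ) : ℝ :=
  -8 * τ * logSlope τ s + 8 * τ ^ 2 * (1 - 2 * s) - 2 * τ * (2 * ν + 8)

theorem hasDerivAt_logSlope (τ s : ℝ) : HasDerivAt (logSlope τ) (2 * τ) s := by
  exact ((((hasDerivAt_id s).const_mul (2 * τ)).sub_const τ).sub_const 1).congr_deriv (mul_one _)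

theorem hasDerivAt_one_sub_two_mul (s : ℝ) : HasDerivAt (fun s : ℝ => 1 - 2 * s) (-2) s := by
  simpa using ((hasDerivAt_id s).const_mul 2).const_sub 1

theorem hasDerivAt_radialCoeff (τ ν s : ℝ) :
    HasDerivAt (radialCoeff τ ν) (radialCoeffDeriv τ ν s) s := by
  have h1 := hasDerivAt_one_sub_two_mul s
  have h2 := hasDerivAt_logSlope τ s
  have h3 : HasDerivAt (fun s : ℝ => ν - (2 * ν + 8) * s) (-(2 * ν + 8)) s := by
    simpa using ((hasDerivAt_id s).const_mul (2 * ν + 8)).const_sub ν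
  have h := (((h1.const_mul (2 * τ)).fun_mul
    ((((h2.fun_pow 2).fun_add ((h1.fun_pow 2).const_mul (τ ^ 2))).add_const ν).sub_const 1)).fun_add
      ((h3.const_mul (2 * τ)).fun_mul h2)).fun_add ((hasDerivAt_id s).const_mul ((4 * ν + 16) * τ))
  refine h.congr_deriv ?_
  simp only [radialCoeffDeriv]
  norm_num
  ring

theorem hasDerivAt_gradCoeff (τ ν s : ℝ) :
    HasDerivAt (gradCoeff τ ν) (gradCoeffDeriv τ ν s) s := by
  have h1 := hasDerivAt_one_sub_two_mul s
  have h2 := hasDerivAt_logSlope τ s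
  have h3 : HasDerivAt (fun s : ℝ => ν - (2 * ν + 8) * s) (-(2 * ν + 8)) s := by
    simpa using ((hasDerivAt_id s).const_mul (2 * ν + 8)).const_sub ν
  have h := ((h1.const_mul (4 * τ)).fun_mul h2).fun_add (h3.const_mul (2 * τ))
  refine h.congr_deriv ?_
  simp only [gradCoeffDeriv]
  ring

/-- The divergence of the Carleman vector field divided by the weight, in terms of
`s = ‖x‖ ^ 2`, `N = ‖∇u‖ ^ 2`, `e = ⟪x, ∇u⟫`, `H = D²u(x, ∇u)`, the Laplacian `L` and
`w = ⟪x, ∇v⟫`. -/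
def carlemanDiv (τ ν s N e u H L v w : ℝ) : ℝ :=
  2 * logSlope τ s * (-2 * τ * (1 - 2 * s) * s * N + radialCoeff τ ν s * u ^ 2 + s ^ 2 * v ^ 2
      + (4 * τ * (1 - 2 * s) * e + gradCoeff τ ν s * u) * e)
    + ν * (-2 * τ * (1 - 2 * s) * s * N + radialCoeff τ ν s * u ^ 2 + s ^ 2 * v ^ 2)
    + (-4 * τ * (1 - 4 * s) * s * N - 4 * τ * (1 - 2 * s) * s * H
      + 2 * s * radialCoeffDeriv τ ν s * u ^ 2 + 2 * radialCoeff τ ν s * u * e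
      + 4 * s ^ 2 * v ^ 2 + 2 * s ^ 2 * v * w)
    + s * (4 * τ * (1 - 2 * s) * e + gradCoeff τ ν s * u) * L
    + 2 * e * (4 * τ * (1 - 2 * s) * e + gradCoeff τ ν s * u)
    + s * (-16 * τ * e ^ 2 + 4 * τ * (1 - 2 * s) * (N + H) + 2 * gradCoeffDeriv τ ν s * e * u
      + gradCoeff τ ν s * N)

theorem carlemanDiv_eq (τ ν s N e u H L v w : ℝ) :
    s ^ 2 * L ^ 2 - carlemanDiv τ ν s N e u H L v w =
      (s * L - (2 * τ * (1 - 2 * s) * e + gradCoeff τ ν s / 2 * u)) ^ 2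
      + (2 * τ * (1 - 2 * s) * e + (gradCoeff τ ν s / 2 + 4 * τ * s) * u) ^ 2
      + 16 * τ * s * (e + logSlope τ s * u) ^ 2
      + 8 * τ * s * (s * N + 2 * logSlope τ s * u * e + logSlope τ s ^ 2 * u ^ 2)
      + (8 * τ ^ 3 * s * (1 - 2 * s) ^ 2 - 16 * τ ^ 2 * s ^ 2
        - (4 * ν ^ 2 + 32 * ν + 24) * τ * s) * u ^ 2
      + s ^ 2 * ((-2 * logSlope τ s - ν - 4) * v ^ 2 - 2 * v * w) := by
  simp only [carlemanDiv, radialCoeff, radialCoeffDeriv, gradCoeff, gradCoeffDeriv, logSlope]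
  ring

set_option maxHeartbeats 1000000 in
theorem le_neg_carlemanDiv {τ ν C s q e u H L v w : ℝ} (hν : 0 ≤ ν) (hC : 0 ≤ C)
    (hτ : 100 * (1 + ν + ν ^ 2 + C + C ^ 2) ≤ τ) (hs : 0 ≤ s) (hs' : s ≤ 1 / 8)
    (he : e ^ 2 ≤ s * q ^ 2) (hL : |L| ≤ C * (|u| + q + |v|)) (hw : |w| ≤ C * (|v| + |u| + q)) :
    s ^ 2 * (u ^ 2 + v ^ 2) ≤ -carlemanDiv τ ν s (q ^ 2) e u H L v w := by
  have hν2 : 0 ≤ ν ^ 2 := sq_nonneg ν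
  have hC2 : 0 ≤ C ^ 2 := sq_nonneg C
  have hτ1 : 100 ≤ τ := by linarith
  have hτ0 : 0 < τ := by linarith
  have hsq : L ^ 2 ≤ 3 * C ^ 2 * (u ^ 2 + q ^ 2 + v ^ 2) := by
    calc L ^ 2 = |L| ^ 2 := (sq_abs L).symm
      _ ≤ (C * (|u| + q + |v|)) ^ 2 := by gcongr
      _ = C ^ 2 * (|u| + q + |v|) ^ 2 := by ring
      _ ≤ C ^ 2 * (3 * (|u| ^ 2 + q ^ 2 + |v| ^ 2)) := by
          gcongr
          nlinarith [sq_nonneg (|u| - q), sq_nonneg (q - |v|), sq_nonneg (|u| - |v|)]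
      _ = _ := by rw [sq_abs, sq_abs]; ring
  have hvw : 2 * v * w ≤ 4 * C * v ^ 2 + C * u ^ 2 + C * q ^ 2 := by
    calc 2 * v * w ≤ |2 * v * w| := le_abs_self _
      _ = 2 * |v| * |w| := by rw [abs_mul, abs_mul]; norm_num
      _ ≤ 2 * |v| * (C * (|v| + |u| + q)) := by gcongr
      _ = C * (2 * |v| ^ 2 + 2 * |v| * |u| + 2 * |v| * q) := by ring
      _ ≤ C * (4 * |v| ^ 2 + |u| ^ 2 + q ^ 2) := by
          refine mul_le_mul_of_nonneg_left ?_ hC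
          nlinarith [sq_nonneg (|u| - |v|), sq_nonneg (q - |v|)]
      _ = _ := by rw [sq_abs, sq_abs]; ring
  have hγ0 : logSlope τ s ≤ -(3 / 4 * τ) := by
    simp only [logSlope]; nlinarith
  have hγ1 : -(2 * τ) ≤ logSlope τ s := by
    simp only [logSlope]; nlinarith
  have hγ2 : logSlope τ s ^ 2 ≤ 4 * τ ^ 2 := by nlinarith
  set γ := logSlope τ s with hγ
  have hX0 : 0 ≤ s * q ^ 2 + 2 * γ * u * e + γ ^ 2 * u ^ 2 := by
    nlinarith [sq_nonneg (e + γ * u)]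
  have hX1 : s * q ^ 2 ≤
      2 * (s * q ^ 2 + 2 * γ * u * e + γ ^ 2 * u ^ 2) + 8 * τ ^ 2 * u ^ 2 := by
    nlinarith [sq_nonneg (e + 2 * γ * u), mul_le_mul_of_nonneg_right hγ2 (sq_nonneg u)]
  have hτs : 0 ≤ τ * s := by positivity
  have hX : 1 / 8 * τ * s ^ 2 * q ^ 2 - τ ^ 3 * s * u ^ 2 ≤
      8 * τ * s * (s * q ^ 2 + 2 * γ * u * e + γ ^ 2 * u ^ 2) := by
    nlinarith [mul_le_mul_of_nonneg_left hX1 hτs, mul_nonneg hτs hX0]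
  have hR : 2 * τ ^ 3 * s ≤ 8 * τ ^ 3 * s * (1 - 2 * s) ^ 2 - 16 * τ ^ 2 * s ^ 2
        - (4 * ν ^ 2 + 32 * ν + 24) * τ * s := by
    have h1 : 9 / 16 ≤ (1 - 2 * s) ^ 2 := by nlinarith
    have h2 : 4 * ν ^ 2 + 32 * ν + 24 ≤ τ := by linarith
    have h3 : 2 * τ ^ 2 ≤ 8 * τ ^ 2 * (1 - 2 * s) ^ 2 - 16 * τ * s - (4 * ν ^ 2 + 32 * ν + 24) := by
      have h4 := mul_le_mul_of_nonneg_left h1 (sq_nonneg τ)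
      have h5 := mul_le_mul_of_nonneg_left hs' hτ0.le
      have h6 := mul_le_mul_of_nonneg_left hτ1 hτ0.le
      linarith
    linarith [mul_le_mul_of_nonneg_left h3 hτs]
  have hRu := mul_le_mul_of_nonneg_right hR (sq_nonneg u)
  have key := carlemanDiv_eq τ ν s (q ^ 2) e u H L v w
  rw [← hγ] at key
  have hs2 : 0 ≤ s ^ 2 := sq_nonneg s
  have hL2 := mul_le_mul_of_nonneg_left hsq hs2
  have hv2 : s ^ 2 * ((1 + 3 * C ^ 2) * v ^ 2 - C * u ^ 2 - C * q ^ 2) ≤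
      s ^ 2 * ((-2 * γ - ν - 4) * v ^ 2 - 2 * v * w) := by
    refine mul_le_mul_of_nonneg_left ?_ hs2
    have : (1 + 3 * C ^ 2 + 4 * C) * v ^ 2 ≤ (-2 * γ - ν - 4) * v ^ 2 :=
      mul_le_mul_of_nonneg_right (by linarith) (sq_nonneg v)
    linarith
  have hu2 : (1 + 3 * C ^ 2 + C) * s ^ 2 * u ^ 2 ≤ τ ^ 3 * s * u ^ 2 := by
    refine mul_le_mul_of_nonneg_right ?_ (sq_nonneg u)
    have h1 : 1 + 3 * C ^ 2 + C ≤ τ ^ 3 := by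
      linarith [le_self_pow₀ (show 1 ≤ τ by linarith) (show (3 : ℕ) ≠ 0 by norm_num)]
    have h2 : s ^ 2 ≤ s := by nlinarith
    exact mul_le_mul h1 h2 hs2 (by positivity)
  have hq2 : (3 * C ^ 2 + C) * (s ^ 2 * q ^ 2) ≤ 1 / 8 * τ * (s ^ 2 * q ^ 2) :=
    mul_le_mul_of_nonneg_right (by linarith) (by positivity)
  have hsqs : 0 ≤ 16 * τ * s * (e + γ * u) ^ 2 := by positivity
  linarith [sq_nonneg (s * L - (2 * τ * (1 - 2 * s) * e + gradCoeff τ ν s / 2 * u)),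
    sq_nonneg (2 * τ * (1 - 2 * s) * e + (gradCoeff τ ν s / 2 + 4 * τ * s) * u)]

variable {n : ℕ}

/-- The divergence of a vector field on Euclidean space. -/
noncomputable def divergence (X : EuclideanSpace ℝ (Fin n) → EuclideanSpace ℝ (Fin n))
    (x : EuclideanSpace ℝ (Fin n)) : ℝ :=
  ∑ i : Fin n, fderiv ℝ X x (EuclideanSpace.single i 1) i

theorem HasFDerivAt.divergence_smul {φ : EuclideanSpace ℝ (Fin n) → ℝ}
    {X : EuclideanSpace ℝ (Fin n) → EuclideanSpace ℝ (Fin n)} {x : EuclideanSpace ℝ (Fin n)}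
    {φ' : EuclideanSpace ℝ (Fin n) →L[ℝ] ℝ} (hφ : HasFDerivAt φ φ' x)
    (hX : DifferentiableAt ℝ X x) :
    divergence (fun y => φ y • X y) x = φ x * divergence X x + φ' (X x) := by
  have h1 : φ' (X x) = ∑ i, X x i * φ' (EuclideanSpace.single i 1) := by
    conv_lhs => rw [← (EuclideanSpace.basisFun (Fin n) ℝ).sum_repr (X x)]
    simp
  rw [divergence, (hφ.fun_smul hX.hasFDerivAt).fderiv, h1, divergence, Finset.mul_sum,
    ← Finset.sum_add_distrib]
  refine Finset.sum_congr rfl fun i _ => ?_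
  simp [mul_comm]

theorem divergence_fun_add {X Y : EuclideanSpace ℝ (Fin n) → EuclideanSpace ℝ (Fin n)}
    {x : EuclideanSpace ℝ (Fin n)} (hX : DifferentiableAt ℝ X x) (hY : DifferentiableAt ℝ Y x) :
    divergence (fun y => X y + Y y) x = divergence X x + divergence Y x := by
  simp [divergence, fderiv_fun_add hX hY, Finset.sum_add_distrib]

theorem divergence_fun_id (x : EuclideanSpace ℝ (Fin n)) :
    divergence (fun y => y) x = n := by
  simp [divergence]

theorem inner_gradient {u : EuclideanSpace ℝ (Fin n) → ℝ} (x h : EuclideanSpace ℝ (Fin n)) :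
    ⟪gradient u x, h⟫_ℝ = fderiv ℝ u x h := by
  rw [gradient, InnerProductSpace.toDual_symm_apply]

theorem contDiff_gradient {u : EuclideanSpace ℝ (Fin n) → ℝ} (hu : ContDiff ℝ ∞ u) :
    ContDiff ℝ ∞ (gradient u) :=
  (InnerProductSpace.toDual ℝ (EuclideanSpace ℝ (Fin n))).symm.contDiff.comp
    (hu.fderiv_right (by simp))

theorem inner_fderiv_gradient {u : EuclideanSpace ℝ (Fin n) → ℝ} (hu : ContDiff ℝ ∞ u)
    (x h k : EuclideanSpace ℝ (Fin n)) :
    ⟪fderiv ℝ (gradient u) x h, k⟫_ℝ = fderiv ℝ (fderiv ℝ u) x h k := by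
  have h1 : DifferentiableAt ℝ (gradient u) x := (contDiff_gradient hu).differentiable (by simp) x
  have h2 := (h1.hasFDerivAt.inner ℝ (hasFDerivAt_const k x)).fderiv
  have h3 : DifferentiableAt ℝ (fderiv ℝ u) x :=
    (hu.fderiv_right (m := ∞) (by simp)).differentiable (by simp) x
  simp_rw [inner_gradient] at h2
  rw [(h3.hasFDerivAt.clm_apply (hasFDerivAt_const k x)).fderiv] at h2
  simpa using (DFunLike.congr_fun h2 h).symm

theorem inner_fderiv_gradient_comm {u : EuclideanSpace ℝ (Fin n) → ℝ} (hu : ContDiff ℝ ∞ u)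
    (x h k : EuclideanSpace ℝ (Fin n)) :
    ⟪fderiv ℝ (gradient u) x h, k⟫_ℝ = ⟪fderiv ℝ (gradient u) x k, h⟫_ℝ := by
  rw [inner_fderiv_gradient hu, inner_fderiv_gradient hu]
  exact (hu.contDiffAt.isSymmSndFDerivAt (by
    rw [minSmoothness_of_isRCLikeNormedField]
    exact WithTop.coe_le_coe.2 (le_top (a := (2 : ℕ∞))))) h k

theorem divergence_gradient {u : EuclideanSpace ℝ (Fin n) → ℝ} (hu : ContDiff ℝ ∞ u)
    (x : EuclideanSpace ℝ (Fin n)) : divergence (gradient u) x = lap u x := by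
  refine Finset.sum_congr rfl fun i _ => ?_
  have := inner_fderiv_gradient hu x (EuclideanSpace.single i 1) (EuclideanSpace.single i 1)
  rw [iteratedFDeriv_two_apply]
  simpa [EuclideanSpace.inner_single_right] using this

/-- Integration by parts against a compactly supported function. -/
theorem integral_mul_divergence {χ : EuclideanSpace ℝ (Fin n) → ℝ}
    {X : EuclideanSpace ℝ (Fin n) → EuclideanSpace ℝ (Fin n)} (hχ : ContDiff ℝ 1 χ)
    (hχc : HasCompactSupport χ) (hX : ContDiff ℝ 1 X) :
    ∫ x, χ x * divergence X x = -∫ x, fderiv ℝ χ x (X x) := by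
  have hXi : ∀ i, ContDiff ℝ 1 fun x => X x i := fun i => by fun_prop
  have hXc : Continuous X := hX.continuous
  have hχ' : ∀ w, Continuous fun x => fderiv ℝ χ x w := fun w =>
    (hχ.continuous_fderiv (by simp)).clm_apply continuous_const
  have hXi' : ∀ i w, Continuous fun x => fderiv ℝ (fun x => X x i) x w := fun i w =>
    ((hXi i).continuous_fderiv (by simp)).clm_apply continuous_const
  have hi1 : ∀ i, Integrable fun x => fderiv ℝ χ x (EuclideanSpace.single i 1) * X x i :=
    fun i => ((hχ' _).mul (hXi i).continuous).integrable_of_hasCompactSupport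
      ((hχc.fderiv_apply (𝕜 := ℝ) _).mul_right)
  have hi2 : ∀ i, Integrable fun x =>
      χ x * fderiv ℝ (fun x => X x i) x (EuclideanSpace.single i 1) :=
    fun i => (hχ.continuous.mul (hXi' i _)).integrable_of_hasCompactSupport hχc.mul_right
  have hi3 : ∀ i, Integrable fun x => χ x * X x i :=
    fun i => (hχ.continuous.mul (hXi i).continuous).integrable_of_hasCompactSupport hχc.mul_right
  have hl : ∀ x, χ x * divergence X x =
      ∑ i, χ x * fderiv ℝ (fun x => X x i) x (EuclideanSpace.single i 1) := fun x => by
    rw [divergence, Finset.mul_sum]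
    refine Finset.sum_congr rfl fun i _ => ?_
    have := ((EuclideanSpace.proj (𝕜 := ℝ) i).hasFDerivAt.comp x
      ((hX.differentiable (by simp)) x).hasFDerivAt).fderiv
    congr 1
    exact (DFunLike.congr_fun this (EuclideanSpace.single i 1)).symm
  have hr : ∀ x, fderiv ℝ χ x (X x) =
      ∑ i, fderiv ℝ χ x (EuclideanSpace.single i 1) * X x i := fun x => by
    conv_lhs => rw [← (EuclideanSpace.basisFun (Fin n) ℝ).sum_repr (X x)]
    simp [mul_comm]
  simp_rw [hl, hr]
  rw [integral_finsetSum _ fun i _ => hi2 i, integral_finsetSum _ fun i _ => hi1 i,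
    ← Finset.sum_neg_distrib]
  exact Finset.sum_congr rfl fun i _ => integral_mul_fderiv_eq_neg_fderiv_mul_of_integrable
    (hi1 i) (hi2 i) (hi3 i) (fun x _ => hχ.differentiable (by simp) x)
    (fun x _ => (hXi i).differentiable (by simp) x)

/-- The radial part of the (unweighted) Carleman vector field. -/
noncomputable def carlemanRadial (τ : ℝ) (u v : EuclideanSpace ℝ (Fin n) → ℝ)
    (x : EuclideanSpace ℝ (Fin n)) : ℝ :=
  -2 * τ * (1 - 2 * ‖x‖ ^ 2) * ‖x‖ ^ 2 * ‖gradient u x‖ ^ 2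
    + radialCoeff τ n (‖x‖ ^ 2) * u x ^ 2 + (‖x‖ ^ 2) ^ 2 * v x ^ 2

/-- The gradient part of the (unweighted) Carleman vector field, divided by `‖x‖ ^ 2`. -/
noncomputable def carlemanGrad (τ : ℝ) (u : EuclideanSpace ℝ (Fin n) → ℝ)
    (x : EuclideanSpace ℝ (Fin n)) : ℝ :=
  4 * τ * (1 - 2 * ‖x‖ ^ 2) * ⟪x, gradient u x⟫_ℝ + gradCoeff τ n (‖x‖ ^ 2) * u x

/-- The Carleman vector field without its weight. -/
noncomputable def carlemanField (τ : ℝ) (u v : EuclideanSpace ℝ (Fin n) → ℝ)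
    (x : EuclideanSpace ℝ (Fin n)) : EuclideanSpace ℝ (Fin n) :=
  carlemanRadial τ u v x • x + (‖x‖ ^ 2 * carlemanGrad τ u x) • gradient u x

/-- The Carleman weight `‖x‖ ^ (-2 * k) * exp (2 * τ * ‖x‖ ^ 2)`. -/
noncomputable def carlemanWeight (τ : ℝ) (k : ℕ) (x : EuclideanSpace ℝ (Fin n)) : ℝ :=
  ((‖x‖ ^ 2) ^ k)⁻¹ * Real.exp (2 * τ * ‖x‖ ^ 2)

theorem hasFDerivAt_carlemanWeight {τ : ℝ} {k : ℕ} (hk : (k : ℝ) = τ + 1)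
    {x : EuclideanSpace ℝ (Fin n)} (hx : x ≠ 0) :
    HasFDerivAt (carlemanWeight τ k)
      ((carlemanWeight τ k x * (2 * logSlope τ (‖x‖ ^ 2) / ‖x‖ ^ 2)) • innerSL ℝ x) x := by
  have h := (hasFDerivAt_inv_norm_sq_pow k hx).fun_mul
    (((hasStrictFDerivAt_norm_sq x).hasFDerivAt.const_mul (2 * τ)).exp)
  refine h.congr_fderiv ?_
  have hs : ‖x‖ ^ 2 ≠ 0 := by positivity
  ext y
  simp only [carlemanWeight, logSlope, add_apply, FunLike.coe_smul, Pi.smul_apply, smul_eq_mul,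
    innerSL_apply_apply, two_nsmul]
  rcases k with _ | k
  · norm_num at hk
    obtain rfl : τ = -1 := by linarith
    field_simp
    norm_num
    ring
  · obtain rfl : τ = k := by push_cast at hk; linarith
    push_cast
    field_simp
    ring

theorem contDiff_radialCoeff (τ ν : ℝ) : ContDiff ℝ ∞ (radialCoeff τ ν) := by
  unfold radialCoeff logSlope
  fun_prop

theorem contDiff_gradCoeff (τ ν : ℝ) : ContDiff ℝ ∞ (gradCoeff τ ν) := by
  unfold gradCoeff logSlope
  fun_prop

theorem contDiff_carlemanGrad (τ : ℝ) {u : EuclideanSpace ℝ (Fin n) → ℝ} (hu : ContDiff ℝ ∞ u) :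
    ContDiff ℝ ∞ (carlemanGrad τ u) := by
  have h1 : ContDiff ℝ ∞ fun x : EuclideanSpace ℝ (Fin n) => ‖x‖ ^ 2 := contDiff_norm_sq ℝ
  have h2 := (contDiff_gradCoeff τ n).comp h1
  have h3 := contDiff_id.inner ℝ (contDiff_gradient hu)
  exact ((contDiff_const.mul (contDiff_const.sub (contDiff_const.mul h1))).mul h3).add (h2.mul hu)

theorem hasFDerivAt_carlemanRadial (τ : ℝ) {u v : EuclideanSpace ℝ (Fin n) → ℝ}
    (hu : ContDiff ℝ ∞ u) (hv : ContDiff ℝ ∞ v) (x : EuclideanSpace ℝ (Fin n)) :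
    ∃ a' : EuclideanSpace ℝ (Fin n) →L[ℝ] ℝ, HasFDerivAt (carlemanRadial τ u v) a' x ∧
      ∀ h, a' h = -4 * τ * (1 - 4 * ‖x‖ ^ 2) * ‖gradient u x‖ ^ 2 * ⟪x, h⟫_ℝ
        - 4 * τ * (1 - 2 * ‖x‖ ^ 2) * ‖x‖ ^ 2 * ⟪gradient u x, fderiv ℝ (gradient u) x h⟫_ℝ
        + 2 * radialCoeffDeriv τ n (‖x‖ ^ 2) * ⟪x, h⟫_ℝ * u x ^ 2
        + 2 * radialCoeff τ n (‖x‖ ^ 2) * u x * fderiv ℝ u x h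
        + 4 * ‖x‖ ^ 2 * ⟪x, h⟫_ℝ * v x ^ 2 + 2 * (‖x‖ ^ 2) ^ 2 * v x * fderiv ℝ v x h := by
  have hs := (hasStrictFDerivAt_norm_sq x).hasFDerivAt
  have hp := ((contDiff_gradient hu).differentiable (by simp) x).hasFDerivAt
  have hN := hp.norm_sq
  have hA := HasDerivAt.comp_hasFDerivAt (f := fun y : EuclideanSpace ℝ (Fin n) => ‖y‖ ^ 2) x
    (hasDerivAt_radialCoeff τ n (‖x‖ ^ 2)) hs
  have hu' := (hu.differentiable (by simp) x).hasFDerivAt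
  have hv' := (hv.differentiable (by simp) x).hasFDerivAt
  refine ⟨_, ((((((hs.const_mul 2).const_sub 1).const_mul (-2 * τ)).fun_mul hs).fun_mul hN).fun_add
    (hA.fun_mul (HasFDerivAt.pow hu' 2))).fun_add
    ((HasFDerivAt.pow hs 2).fun_mul (HasFDerivAt.pow hv' 2)), fun h => ?_⟩
  simp
  ring

theorem hasFDerivAt_carlemanGrad (τ : ℝ) {u : EuclideanSpace ℝ (Fin n) → ℝ}
    (hu : ContDiff ℝ ∞ u) (x : EuclideanSpace ℝ (Fin n)) :
    ∃ b' : EuclideanSpace ℝ (Fin n) →L[ℝ] ℝ, HasFDerivAt (carlemanGrad τ u) b' x ∧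
      ∀ h, b' h = -16 * τ * ⟪x, h⟫_ℝ * ⟪x, gradient u x⟫_ℝ
        + 4 * τ * (1 - 2 * ‖x‖ ^ 2) *
          (⟪h, gradient u x⟫_ℝ + ⟪x, fderiv ℝ (gradient u) x h⟫_ℝ)
        + 2 * gradCoeffDeriv τ n (‖x‖ ^ 2) * ⟪x, h⟫_ℝ * u x
        + gradCoeff τ n (‖x‖ ^ 2) * fderiv ℝ u x h := by
  have hs := (hasStrictFDerivAt_norm_sq x).hasFDerivAt
  have hp := ((contDiff_gradient hu).differentiable (by simp) x).hasFDerivAt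
  have he := (hasFDerivAt_id x).inner ℝ hp
  have hA := HasDerivAt.comp_hasFDerivAt (f := fun y : EuclideanSpace ℝ (Fin n) => ‖y‖ ^ 2) x
    (hasDerivAt_gradCoeff τ n (‖x‖ ^ 2)) hs
  have hu' := (hu.differentiable (by simp) x).hasFDerivAt
  refine ⟨_, ((((hs.const_mul 2).const_sub 1).const_mul (4 * τ)).fun_mul he).fun_add
    (hA.fun_mul hu'), fun h => ?_⟩
  simp
  ring

theorem divergence_carlemanWeight_smul {τ : ℝ} {k : ℕ} (hk : (k : ℝ) = τ + 1)
    {u v : EuclideanSpace ℝ (Fin n) → ℝ} (hu : ContDiff ℝ ∞ u) (hv : ContDiff ℝ ∞ v)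
    {x : EuclideanSpace ℝ (Fin n)} (hx : x ≠ 0) :
    divergence (fun y => carlemanWeight τ k y • carlemanField τ u v y) x =
      carlemanWeight τ k x * carlemanDiv τ n (‖x‖ ^ 2) (‖gradient u x‖ ^ 2) (fderiv ℝ u x x) (u x)
        ⟪gradient u x, fderiv ℝ (gradient u) x x⟫_ℝ (lap u x) (v x) (fderiv ℝ v x x) := by
  have hs : ‖x‖ ^ 2 ≠ 0 := by positivity
  obtain ⟨a', ha, ha'⟩ := hasFDerivAt_carlemanRadial τ hu hv x
  obtain ⟨b', hb, hb'⟩ := hasFDerivAt_carlemanGrad τ hu x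
  have hp : DifferentiableAt ℝ (gradient u) x := (contDiff_gradient hu).differentiable (by simp) x
  have hb2 := (hasStrictFDerivAt_norm_sq x).hasFDerivAt.fun_mul hb
  have hY1 : DifferentiableAt ℝ (fun y => carlemanRadial τ u v y • y) x :=
    ha.differentiableAt.smul differentiableAt_id
  have hY2 : DifferentiableAt ℝ (fun y => (‖y‖ ^ 2 * carlemanGrad τ u y) • gradient u y) x :=
    hb2.differentiableAt.smul hp
  have hdiv : divergence (carlemanField τ u v) x = _ :=
    (divergence_fun_add hY1 hY2).trans (congrArg₂ (· + ·)
      (ha.divergence_smul differentiableAt_id) (hb2.divergence_smul hp))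
  rw [(hasFDerivAt_carlemanWeight hk hx).divergence_smul (X := carlemanField τ u v) (hY1.add hY2),
    hdiv]
  have he : ⟪x, gradient u x⟫_ℝ = fderiv ℝ u x x := by rw [real_inner_comm, inner_gradient]
  have hN : fderiv ℝ u x (gradient u x) = ‖gradient u x‖ ^ 2 := by
    rw [← inner_gradient, real_inner_self_eq_norm_sq]
  have hH : ⟪x, fderiv ℝ (gradient u) x (gradient u x)⟫_ℝ =
      ⟪gradient u x, fderiv ℝ (gradient u) x x⟫_ℝ := by
    rw [real_inner_comm, inner_fderiv_gradient_comm hu, real_inner_comm]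
  have hid : divergence (fun y : EuclideanSpace ℝ (Fin n) => y) x = n := divergence_fun_id x
  simp only [carlemanField, divergence_gradient hu, ha', hb', add_apply,
    FunLike.coe_smul, Pi.smul_apply, smul_eq_mul, innerSL_apply_apply, two_nsmul, inner_add_right,
    inner_smul_right, he, hN, hH, real_inner_self_eq_norm_sq, hid]
  simp only [carlemanRadial, carlemanGrad, carlemanDiv, he]
  field_simp
  ring

theorem IsFlat.gradient {u : EuclideanSpace ℝ (Fin n) → ℝ} (hu : IsFlat u) :
    IsFlat (gradient u) :=
  hu.fderiv.clm_comp
    (InnerProductSpace.toDual ℝ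
      (EuclideanSpace ℝ (Fin n))).symm.toContinuousLinearEquiv.toContinuousLinearMap

theorem IsFlat.carlemanField (τ : ℝ) {u v : EuclideanSpace ℝ (Fin n) → ℝ} (hu : IsFlat u)
    (hv : IsFlat v) : IsFlat (carlemanField τ u v) := by
  have hs : ContDiff ℝ ∞ fun x : EuclideanSpace ℝ (Fin n) => ‖x‖ ^ 2 := contDiff_norm_sq ℝ
  have hA := ((contDiff_radialCoeff τ n).comp hs).mul hu.smooth
  have hc : ContDiff ℝ ∞ fun x : EuclideanSpace ℝ (Fin n) =>
    -2 * τ * (1 - 2 * ‖x‖ ^ 2) * ‖x‖ ^ 2 := by fun_prop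
  have hN : IsFlat fun x => ‖_root_.gradient u x‖ ^ 2 := by
    convert hu.gradient.bilinear (innerSL ℝ) hu.gradient.smooth using 2
    exact (real_inner_self_eq_norm_sq _).symm
  have h := (((hN.smul_left hc).add (hu.smul_left hA)).add
    (hv.smul_left ((hs.pow 2).mul hv.smooth))).smul_right
    contDiff_id
  convert h.add (hu.gradient.smul_left (hs.mul (contDiff_carlemanGrad τ hu.smooth))) using 1
  ext1 x
  simp only [_root_.carlemanField, carlemanRadial, smul_eq_mul, Function.comp_apply,
    id, pow_two, mul_assoc]

theorem contDiff_carlemanWeight_smul (τ : ℝ) (k : ℕ) {u v : EuclideanSpace ℝ (Fin n) → ℝ}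
    (hu : IsFlat u) (hv : IsFlat v) :
    ContDiff ℝ 1 fun x => carlemanWeight τ k x • carlemanField τ u v x := by
  have hs : ContDiff ℝ ∞ fun x : EuclideanSpace ℝ (Fin n) => ‖x‖ ^ 2 := contDiff_norm_sq ℝ
  simpa only [carlemanWeight, mul_smul] using ((hu.carlemanField τ hv).smul_left
    (contDiff_const.mul hs).exp).contDiff_inv_pow_smul k

theorem continuous_divergence {X : EuclideanSpace ℝ (Fin n) → EuclideanSpace ℝ (Fin n)}
    (hX : ContDiff ℝ 1 X) : Continuous (divergence X) := by
  have := hX.continuous_fderiv (by simp)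
  unfold divergence
  fun_prop

theorem norm_carlemanField_le {τ B : ℝ} (hτ : 1 ≤ τ) {u v : EuclideanSpace ℝ (Fin n) → ℝ}
    {x : EuclideanSpace ℝ (Fin n)} (hx : ‖x‖ ≤ 1 / 4) (hu : |u x| ≤ B) (hv : |v x| ≤ B)
    (hp : ‖gradient u x‖ ≤ B) :
    ‖carlemanField τ u v x‖ ≤ (91 + 24 * n) * B ^ 2 * τ ^ 3 := by
  have hB : 0 ≤ B := (norm_nonneg _).trans hp
  have hτ0 : 0 ≤ τ := by linarith
  have hn : (0 : ℝ) ≤ n := n.cast_nonneg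
  have hs0 : 0 ≤ ‖x‖ ^ 2 := sq_nonneg _
  have hs : ‖x‖ ^ 2 ≤ 1 / 4 := by nlinarith [norm_nonneg x]
  have hτ2 : τ ≤ τ ^ 2 := le_self_pow₀ hτ two_ne_zero
  have hτ3 : τ ^ 2 ≤ τ ^ 3 := pow_le_pow_right₀ hτ (by norm_num)
  have h1 : |1 - 2 * ‖x‖ ^ 2| ≤ 1 := abs_le.2 ⟨by linarith, by linarith⟩
  have h1' : (1 - 2 * ‖x‖ ^ 2) ^ 2 ≤ 1 := (sq_le_one_iff_abs_le_one _).2 h1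
  have hγ : |logSlope τ (‖x‖ ^ 2)| ≤ 2 * τ := by
    unfold logSlope
    exact abs_le.2 ⟨by nlinarith, by nlinarith⟩
  have hγ2 : logSlope τ (‖x‖ ^ 2) ^ 2 ≤ (2 * τ) ^ 2 := sq_le_sq' (abs_le.1 hγ).1 (abs_le.1 hγ).2
  have h2 : |(n : ℝ) - (2 * n + 8) * ‖x‖ ^ 2| ≤ (n : ℝ) + 2 :=
    abs_le.2 ⟨by nlinarith, by nlinarith⟩
  have hg : |gradCoeff τ n (‖x‖ ^ 2)| ≤ (12 + 2 * n) * τ ^ 2 := by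
    calc _ ≤ |4 * τ * (1 - 2 * ‖x‖ ^ 2) * logSlope τ (‖x‖ ^ 2)|
          + |2 * τ * (n - (2 * n + 8) * ‖x‖ ^ 2)| := abs_add_le _ _
      _ = 4 * τ * |1 - 2 * ‖x‖ ^ 2| * |logSlope τ (‖x‖ ^ 2)|
          + 2 * τ * |n - (2 * n + 8) * ‖x‖ ^ 2| := by
        simp only [abs_mul, abs_of_nonneg hτ0, Nat.abs_ofNat]
      _ ≤ 4 * τ * 1 * (2 * τ) + 2 * τ * (n + 2) := by gcongr
      _ ≤ _ := by nlinarith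
  have hA : |radialCoeff τ n (‖x‖ ^ 2)| ≤ (24 + 8 * n) * τ ^ 3 := by
    have h3 : |logSlope τ (‖x‖ ^ 2) ^ 2 + τ ^ 2 * (1 - 2 * ‖x‖ ^ 2) ^ 2 + n - 1| ≤
        5 * τ ^ 2 + n := by
      have := mul_le_mul_of_nonneg_left h1' (sq_nonneg τ)
      refine abs_le.2 ⟨?_, by linarith⟩
      nlinarith [sq_nonneg (logSlope τ (‖x‖ ^ 2)),
        mul_nonneg (sq_nonneg τ) (sq_nonneg (1 - 2 * ‖x‖ ^ 2))]
    calc _ ≤ |2 * τ * (1 - 2 * ‖x‖ ^ 2) *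
            (logSlope τ (‖x‖ ^ 2) ^ 2 + τ ^ 2 * (1 - 2 * ‖x‖ ^ 2) ^ 2 + n - 1)|
          + |2 * τ * (n - (2 * n + 8) * ‖x‖ ^ 2) * logSlope τ (‖x‖ ^ 2)|
          + |(4 * n + 16) * τ * ‖x‖ ^ 2| := abs_add_three _ _ _
      _ = 2 * τ * |1 - 2 * ‖x‖ ^ 2| *
            |logSlope τ (‖x‖ ^ 2) ^ 2 + τ ^ 2 * (1 - 2 * ‖x‖ ^ 2) ^ 2 + n - 1|
          + 2 * τ * |n - (2 * n + 8) * ‖x‖ ^ 2| * |logSlope τ (‖x‖ ^ 2)|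
          + (4 * n + 16) * τ * ‖x‖ ^ 2 := by
        rw [abs_mul (2 * τ * _), abs_mul (2 * τ), abs_mul (2 * τ * _), abs_mul (2 * τ),
          abs_of_nonneg (by positivity : 0 ≤ 2 * τ),
          abs_of_nonneg (by positivity : 0 ≤ (4 * (n : ℝ) + 16) * τ * ‖x‖ ^ 2)]
      _ ≤ 2 * τ * 1 * (5 * τ ^ 2 + n) + 2 * τ * (n + 2) * (2 * τ)
          + (4 * n + 16) * τ * (1 / 4) := by gcongr
      _ = 10 * τ ^ 3 + (8 + 4 * n) * τ ^ 2 + (3 * n + 4) * τ := by ring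
      _ ≤ _ := by nlinarith
  have hr : |carlemanRadial τ u v x| ≤ (27 + 8 * n) * B ^ 2 * τ ^ 3 := by
    calc _ ≤ |-2 * τ * (1 - 2 * ‖x‖ ^ 2) * ‖x‖ ^ 2 * ‖gradient u x‖ ^ 2|
          + |radialCoeff τ n (‖x‖ ^ 2) * u x ^ 2| + |(‖x‖ ^ 2) ^ 2 * v x ^ 2| :=
        abs_add_three _ _ _
      _ = 2 * τ * |1 - 2 * ‖x‖ ^ 2| * ‖x‖ ^ 2 * ‖gradient u x‖ ^ 2
          + |radialCoeff τ n (‖x‖ ^ 2)| * |u x| ^ 2 + (‖x‖ ^ 2) ^ 2 * |v x| ^ 2 := by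
        simp only [abs_mul, abs_pow, abs_norm, abs_neg, abs_of_nonneg hτ0, Nat.abs_ofNat]
      _ ≤ 2 * τ * 1 * (1 / 4) * B ^ 2 + (24 + 8 * n) * τ ^ 3 * B ^ 2 + (1 / 4) ^ 2 * B ^ 2 := by
        gcongr
      _ = (1 / 2 * τ + (24 + 8 * n) * τ ^ 3 + 1 / 16) * B ^ 2 := by ring
      _ ≤ ((27 + 8 * n) * τ ^ 3) * B ^ 2 := by
        gcongr
        nlinarith
      _ = _ := by ring
  have hb : |carlemanGrad τ u x| ≤ (16 + 2 * n) * B * τ ^ 3 := by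
    calc _ ≤ |4 * τ * (1 - 2 * ‖x‖ ^ 2) * ⟪x, gradient u x⟫_ℝ|
          + |gradCoeff τ n (‖x‖ ^ 2) * u x| := abs_add_le _ _
      _ = 4 * τ * |1 - 2 * ‖x‖ ^ 2| * |⟪x, gradient u x⟫_ℝ|
          + |gradCoeff τ n (‖x‖ ^ 2)| * |u x| := by
        simp only [abs_mul, abs_of_nonneg hτ0, Nat.abs_ofNat]
      _ ≤ 4 * τ * 1 * (1 / 4 * B) + (12 + 2 * n) * τ ^ 2 * B := by
        gcongr
        exact (abs_real_inner_le_norm _ _).trans (by gcongr)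
      _ = (τ + (12 + 2 * n) * τ ^ 2) * B := by ring
      _ ≤ ((16 + 2 * n) * τ ^ 3) * B := by
        gcongr
        nlinarith
      _ = _ := by ring
  calc ‖carlemanField τ u v x‖
      ≤ ‖carlemanRadial τ u v x • x‖ + ‖(‖x‖ ^ 2 * carlemanGrad τ u x) • gradient u x‖ :=
        norm_add_le _ _
    _ = |carlemanRadial τ u v x| * ‖x‖ + ‖x‖ ^ 2 * |carlemanGrad τ u x| * ‖gradient u x‖ := by
        simp only [norm_smul, norm_mul, Real.norm_eq_abs, abs_pow, abs_norm]
    _ ≤ (27 + 8 * n) * B ^ 2 * τ ^ 3 * (1 / 4) + 1 / 4 * ((16 + 2 * n) * B * τ ^ 3) * B := by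
        gcongr
    _ = (43 / 4 + 5 / 2 * n) * (B ^ 2 * τ ^ 3) := by ring
    _ ≤ (91 + 24 * n) * (B ^ 2 * τ ^ 3) := by
        gcongr
        · norm_num
        · norm_num
    _ = _ := by ring

/-- Exponential decay of the profile of the Carleman weight. -/
theorem inv_pow_mul_exp_le {τ s t : ℝ} {k : ℕ} (hτ : τ ≤ k) (hs : 0 < s) (hst : s ≤ t)
    (ht8 : t ≤ 1 / 8) :
    (t ^ k)⁻¹ * Real.exp (2 * τ * t) ≤
      Real.exp (-(6 * k * (t - s))) * ((s ^ k)⁻¹ * Real.exp (2 * τ * s)) := by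
  have ht : 0 < t := hs.trans_le hst
  have h1 : Real.exp (8 * (t - s)) * s ≤ t := by
    rw [← le_div_iff₀ hs, ← Real.le_log_iff_exp_le (by positivity)]
    refine le_trans ?_ (Real.one_sub_inv_le_log_of_pos (by positivity))
    rw [inv_div, one_sub_div ht.ne', le_div_iff₀ ht]
    nlinarith
  have h2 : Real.exp (8 * k * (t - s)) * s ^ k ≤ t ^ k := by
    have := pow_le_pow_left₀ (by positivity) h1 k
    rwa [mul_pow, ← Real.exp_nat_mul, show (k : ℝ) * (8 * (t - s)) = 8 * k * (t - s) by ring]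
      at this
  calc (t ^ k)⁻¹ * Real.exp (2 * τ * t)
      ≤ (Real.exp (8 * k * (t - s)) * s ^ k)⁻¹ * Real.exp (2 * τ * s + 2 * k * (t - s)) := by
        gcongr
        nlinarith
    _ = _ := by
        rw [mul_inv, ← Real.exp_neg, mul_right_comm, ← Real.exp_add,
          mul_left_comm, ← Real.exp_add, mul_comm]
        congr 2
        ring

theorem carlemanWeight_mul_le_neg_divergence {τ C : ℝ} {k : ℕ} (hk : (k : ℝ) = τ + 1)
    (hC : 0 ≤ C) (hτ : 100 * (1 + n + n ^ 2 + C + C ^ 2) ≤ τ)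
    {u v : EuclideanSpace ℝ (Fin n) → ℝ} (hu : ContDiff ℝ ∞ u) (hv : ContDiff ℝ ∞ v)
    {x : EuclideanSpace ℝ (Fin n)} (hx : x ≠ 0) (hx' : ‖x‖ ≤ 1 / 4)
    (hpde : |lap u x| ≤ C * (|u x| + ‖gradient u x‖ + |v x|))
    (hode : |fderiv ℝ v x x| ≤ C * (|v x| + |u x| + ‖gradient u x‖)) :
    carlemanWeight τ k x * ((‖x‖ ^ 2) ^ 2 * (u x ^ 2 + v x ^ 2)) ≤
      -divergence (fun y => carlemanWeight τ k y • carlemanField τ u v y) x := by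
  rw [divergence_carlemanWeight_smul hk hu hv hx, ← mul_neg]
  have hw : 0 ≤ carlemanWeight τ k x := by unfold carlemanWeight; positivity
  refine mul_le_mul_of_nonneg_left (le_neg_carlemanDiv n.cast_nonneg hC hτ (sq_nonneg _)
    (by nlinarith [norm_nonneg x]) ?_ hpde hode) hw
  rw [← inner_gradient, ← sq_abs, ← mul_pow, mul_comm]
  gcongr
  exact abs_real_inner_le_norm _ _

/-- The Carleman estimate: the cut-off energy decays faster than any fixed power. -/
theorem exists_integral_bump_le [NeZero n] {C R : ℝ} (hC : 0 ≤ C)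
    {u v : EuclideanSpace ℝ (Fin n) → ℝ} (hu : IsFlat u) (hv : IsFlat v) (hR : 0 < R)
    (hR' : R ≤ 1 / 4)
    (hpde : ∀ x ∈ closedBall 0 R, |lap u x| ≤ C * (|u x| + ‖gradient u x‖ + |v x|))
    (hode : ∀ x ∈ closedBall 0 R, |fderiv ℝ v x x| ≤ C * (|v x| + |u x| + ‖gradient u x‖))
    (η : ContDiffBump (0 : EuclideanSpace ℝ (Fin n))) (hη : η.rOut = R / 4) :
    ∃ c D : ℝ, 0 < c ∧ ∀ᶠ k : ℕ in Filter.atTop,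
      ∫ x, η x * ((‖x‖ ^ 2) ^ 2 * (u x ^ 2 + v x ^ 2)) ≤ D * (k ^ 3 * Real.exp (-(c * k))) := by
  have huc := hu.smooth.continuous
  have hvc := hv.smooth.continuous
  have hpc : Continuous (gradient u) := (contDiff_gradient hu.smooth).continuous
  let χ : ContDiffBump (0 : EuclideanSpace ℝ (Fin n)) := ⟨R / 2, R, by linarith, by linarith⟩
  obtain ⟨B, hB⟩ := (isCompact_closedBall 0 R).exists_bound_of_continuousOn
    (f := fun x => (u x, v x, gradient u x)) (by fun_prop)
  set K : ℝ := ∫ x, ‖fderiv ℝ χ x‖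
  have hχ1 : ContDiff ℝ 1 χ := χ.contDiff
  have hχ' : Continuous fun x => fderiv ℝ χ x := hχ1.continuous_fderiv (by simp)
  have hK : 0 ≤ K := integral_nonneg fun _ => norm_nonneg _
  refine ⟨6 * ((R / 2) ^ 2 - (R / 4) ^ 2), (91 + 24 * n) * B ^ 2 * K, by nlinarith, ?_⟩
  obtain ⟨k₀, hk₀⟩ := exists_nat_ge (100 * (1 + n + n ^ 2 + C + C ^ 2) + 1)
  filter_upwards [Filter.eventually_ge_atTop k₀] with k hkk
  have hkk' : 100 * (1 + n + n ^ 2 + C + C ^ 2) + 1 ≤ (k : ℝ) := hk₀.trans (by exact_mod_cast hkk)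
  set τ : ℝ := k - 1 with hτ
  have hkτ : (k : ℝ) = τ + 1 := by ring
  have hτk : τ ≤ k := by linarith
  have hτ1 : 1 ≤ τ := by
    have : (0 : ℝ) ≤ n + n ^ 2 + C + C ^ 2 := by positivity
    linarith
  have hτC : 100 * (1 + n + n ^ 2 + C + C ^ 2) ≤ τ := by linarith
  set W : ℝ := (((R / 4) ^ 2) ^ k)⁻¹ * Real.exp (2 * τ * (R / 4) ^ 2) with hW
  have hW0 : 0 < W := by positivity
  set Φ := fun y => carlemanWeight τ k y • carlemanField τ u v y with hΦ
  have hΦ1 : ContDiff ℝ 1 Φ := contDiff_carlemanWeight_smul τ k hu hv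
  set M : ℝ := Real.exp (-(6 * k * ((R / 2) ^ 2 - (R / 4) ^ 2))) * W *
    ((91 + 24 * n) * B ^ 2 * τ ^ 3) with hM
  have hpoint : ∀ x ≠ 0, W * (η x * ((‖x‖ ^ 2) ^ 2 * (u x ^ 2 + v x ^ 2))) ≤
      -(χ x * divergence Φ x) := by
    intro x hx
    have hw : 0 ≤ carlemanWeight τ k x := by unfold carlemanWeight; positivity
    have hg : 0 ≤ (‖x‖ ^ 2) ^ 2 * (u x ^ 2 + v x ^ 2) := by positivity
    by_cases hxR : x ∈ closedBall 0 R
    · have h := carlemanWeight_mul_le_neg_divergence hkτ hC hτC hu.smooth hv.smooth hx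
        ((mem_closedBall_zero_iff.1 hxR).trans hR') (hpde x hxR) (hode x hxR)
      by_cases hxη : ‖x‖ < R / 4
      · rw [χ.one_of_mem_closedBall (mem_closedBall_zero_iff.2 (by simp only [χ]; linarith)),
          one_mul]
        refine le_trans ?_ h
        have h1 := inv_pow_mul_exp_le hτk (pow_pos (norm_pos_iff.2 hx) 2)
          (pow_le_pow_left₀ (norm_nonneg x) hxη.le 2) (by nlinarith)
        have h2 : W ≤ carlemanWeight τ k x := h1.trans (mul_le_of_le_one_left hw
          (Real.exp_le_one_iff.2 (neg_nonpos.2 (mul_nonneg (by positivity) (sub_nonneg.2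
            (pow_le_pow_left₀ (norm_nonneg x) hxη.le 2))))))
        exact mul_le_mul h2 (mul_le_of_le_one_left hg η.le_one) (mul_nonneg η.nonneg hg) hw
      · rw [η.zero_of_le_dist (by rw [dist_zero_right, hη]; linarith), zero_mul, mul_zero,
          ← mul_neg]
        exact mul_nonneg χ.nonneg ((mul_nonneg hw hg).trans h)
    · rw [mem_closedBall_zero_iff, not_le] at hxR
      rw [η.zero_of_le_dist (by rw [dist_zero_right, hη]; linarith),
        χ.zero_of_le_dist (by rw [dist_zero_right]; exact hxR.le)]
      simp
  have hbound : ∀ x, ‖fderiv ℝ χ x (Φ x)‖ ≤ ‖fderiv ℝ χ x‖ * M := by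
    intro x
    by_cases hx0 : fderiv ℝ χ x = 0
    · simp [hx0]
    have hx1 : ‖x‖ ≤ R := by
      have := support_fderiv_subset ℝ hx0
      rwa [χ.tsupport_eq, mem_closedBall_zero_iff] at this
    have hx2 : R / 2 ≤ ‖x‖ := by
      by_contra! hlt
      refine hx0 ?_
      rw [(χ.eventuallyEq_one_of_mem_ball (mem_ball_zero_iff.2 hlt)).fderiv_eq]
      simp [Pi.one_def]
    have hBx := hB x (mem_closedBall_zero_iff.2 hx1)
    have hfield := norm_carlemanField_le hτ1 (hx1.trans hR')
      ((norm_fst_le _).trans hBx) ((norm_fst_le _).trans ((norm_snd_le _).trans hBx))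
      ((norm_snd_le _).trans ((norm_snd_le _).trans hBx))
    have hweight : carlemanWeight τ k x ≤
        Real.exp (-(6 * k * ((R / 2) ^ 2 - (R / 4) ^ 2))) * W := by
      refine (inv_pow_mul_exp_le hτk (s := (R / 4) ^ 2) (by positivity) (by gcongr; linarith)
        (by nlinarith [norm_nonneg x])).trans ?_
      rw [← hW]
      gcongr
    refine (ContinuousLinearMap.le_opNorm _ _).trans ?_
    have hw : 0 ≤ carlemanWeight τ k x := by unfold carlemanWeight; positivity
    rw [hΦ, norm_smul, Real.norm_of_nonneg hw, hM]
    gcongr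
  have hI1 : Integrable fun x => χ x * divergence Φ x :=
    (hχ1.continuous.mul (continuous_divergence hΦ1)).integrable_of_hasCompactSupport
      χ.hasCompactSupport.mul_right
  have hI2 : Integrable fun x => W * (η x * ((‖x‖ ^ 2) ^ 2 * (u x ^ 2 + v x ^ 2))) :=
    (Continuous.integrable_of_hasCompactSupport (by have := η.continuous; fun_prop)
      η.hasCompactSupport.mul_right).const_mul _
  have hI3 : Integrable fun x => ‖fderiv ℝ χ x‖ * M :=
    (hχ'.norm.integrable_of_hasCompactSupport
      (χ.hasCompactSupport.fderiv (𝕜 := ℝ)).norm).mul_const _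
  have hae : ∀ᵐ x : EuclideanSpace ℝ (Fin n),
      W * (η x * ((‖x‖ ^ 2) ^ 2 * (u x ^ 2 + v x ^ 2))) ≤ -(χ x * divergence Φ x) := by
    filter_upwards [Measure.ae_ne volume (0 : EuclideanSpace ℝ (Fin n))] with x hx using hpoint x hx
  have key : W * ∫ x, η x * ((‖x‖ ^ 2) ^ 2 * (u x ^ 2 + v x ^ 2)) ≤ K * M :=
    calc _ = ∫ x, W * (η x * ((‖x‖ ^ 2) ^ 2 * (u x ^ 2 + v x ^ 2))) :=
          (integral_const_mul _ _).symm
      _ ≤ ∫ x, -(χ x * divergence Φ x) := integral_mono_ae hI2 hI1.neg hae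
      _ = ∫ x, fderiv ℝ χ x (Φ x) := by
          rw [integral_neg, integral_mul_divergence hχ1 χ.hasCompactSupport hΦ1, neg_neg]
      _ ≤ ‖∫ x, fderiv ℝ χ x (Φ x)‖ := Real.le_norm_self _
      _ ≤ ∫ x, ‖fderiv ℝ χ x‖ * M :=
          norm_integral_le_of_norm_le hI3 (Filter.Eventually.of_forall hbound)
      _ = K * M := integral_mul_const _ _
  refine le_of_mul_le_mul_left (key.trans ?_) hW0
  calc K * M = W * ((91 + 24 * n) * B ^ 2 * K *
        (τ ^ 3 * Real.exp (-(6 * ((R / 2) ^ 2 - (R / 4) ^ 2) * k)))) := by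
        rw [hM, mul_right_comm 6]
        ring
    _ ≤ _ := by gcongr

theorem IsFlat.eq_zero_of_abs_lap_le [NeZero n] {C R : ℝ} (hC : 0 ≤ C)
    {u v : EuclideanSpace ℝ (Fin n) → ℝ} (hu : IsFlat u) (hv : IsFlat v) (hR : 0 < R)
    (hR' : R ≤ 1 / 4)
    (hpde : ∀ x ∈ closedBall 0 R, |lap u x| ≤ C * (|u x| + ‖_root_.gradient u x‖ + |v x|))
    (hode : ∀ x ∈ closedBall 0 R,
      |_root_.fderiv ℝ v x x| ≤ C * (|v x| + |u x| + ‖_root_.gradient u x‖)) :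
    ∀ x ∈ ball 0 (R / 8), u x = 0 ∧ v x = 0 := by
  have huc := hu.smooth.continuous
  have hvc := hv.smooth.continuous
  let η : ContDiffBump (0 : EuclideanSpace ℝ (Fin n)) := ⟨R / 8, R / 4, by linarith, by linarith⟩
  obtain ⟨c, D, hc, hD⟩ := exists_integral_bump_le hC hu hv hR hR' hpde hode η rfl
  set g := fun x => η x * ((‖x‖ ^ 2) ^ 2 * (u x ^ 2 + v x ^ 2)) with hg
  have hgc : Continuous g := by have := η.continuous; fun_prop
  have hg0 : 0 ≤ g := fun x => mul_nonneg η.nonneg (by positivity)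
  have hlim : Filter.Tendsto (fun k : ℕ => D * ((k : ℝ) ^ 3 * Real.exp (-(c * k))))
      Filter.atTop (𝓝 0) := by
    have h := ((Real.tendsto_pow_mul_exp_neg_atTop_nhds_zero 3).comp
      (tendsto_natCast_atTop_atTop.const_mul_atTop hc)).const_mul (D / c ^ 3)
    rw [mul_zero] at h
    refine h.congr fun k => ?_
    simp only [Function.comp_apply]
    field_simp
  have hI : ∫ x, g x ≤ 0 := ge_of_tendsto hlim hD
  have hgz : g = 0 := by
    by_contra hne
    exact (hgc.integral_pos_of_hasCompactSupport_nonneg_nonzero η.hasCompactSupport.mul_right hg0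
      (x := (Function.ne_iff.1 hne).choose) (Function.ne_iff.1 hne).choose_spec).not_ge hI
  intro x hx
  rcases eq_or_ne x 0 with rfl | hx0
  · exact ⟨hu.apply_zero, hv.apply_zero⟩
  have h := congrFun hgz x
  simp only [hg, η.one_of_mem_closedBall (ball_subset_closedBall hx), one_mul, Pi.zero_apply] at h
  have h2 := (mul_eq_zero.1 h).resolve_left (by positivity)
  constructor <;> nlinarith [sq_nonneg (u x), sq_nonneg (v x)]

/-- A smooth function on a neighborhood of the origin whose derivatives vanish there agrees near
the origin with a flat function. -/
theorem exists_isFlat_eqOn {U : Set (EuclideanSpace ℝ (Fin n))} (hU : IsOpen U)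
    {f : EuclideanSpace ℝ (Fin n) → ℝ} (hf : ContDiffOn ℝ ∞ f U)
    (h0 : ∀ k : ℕ, iteratedFDeriv ℝ k f 0 = 0)
    (χ : ContDiffBump (0 : EuclideanSpace ℝ (Fin n))) (hχ : closedBall 0 χ.rOut ⊆ U) :
    IsFlat (fun x => χ x * f x) ∧ ∀ x ∈ ball 0 χ.rIn, (fun x => χ x * f x) =ᶠ[𝓝 x] f := by
  have heq : ∀ x ∈ ball 0 χ.rIn, (fun x => χ x * f x) =ᶠ[𝓝 x] f := fun x hx => by
    filter_upwards [χ.eventuallyEq_one_of_mem_ball hx] with y hy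
    simp [hy]
  refine ⟨⟨contDiff_iff_contDiffAt.2 fun x => ?_, fun k => ?_⟩, heq⟩
  · by_cases hx : x ∈ tsupport χ
    · rw [χ.tsupport_eq] at hx
      exact χ.contDiffAt.mul (hf.contDiffAt (hU.mem_nhds (hχ hx)))
    · refine contDiffAt_const (c := (0 : ℝ)) |>.congr_of_eventuallyEq ?_
      filter_upwards [notMem_tsupport_iff_eventuallyEq.1 hx] with y hy
      simp [hy]
  · rw [((heq 0 (mem_ball_self χ.rIn_pos)).iteratedFDeriv ℝ k).eq_of_nhds, h0]

end

/-- Strong unique continuation for the model PDE–ODE system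
(Proposition 2.3 / Remark 2.4): if smooth `u, v` on a neighborhood of the origin satisfy
`|Δu| ≤ C(|u| + |∇u| + |v|)` and `|Y(v)| ≤ C(|v| + |u| + |∇u|)`, where
`Y(v)(x) = ⟨x, ∇v(x)⟩`, and both vanish to infinite order at the origin, then
`u ≡ v ≡ 0` on some neighborhood of the origin. -/
theorem sucp_pde_ode_system (n : ℕ) (hn : 2 < n) (C : ℝ) (hC : 0 ≤ C)
    (U : Set (EuclideanSpace ℝ (Fin n))) (hU : IsOpen U) (h0U : (0 : EuclideanSpace ℝ (Fin n)) ∈ U)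
    (u v : EuclideanSpace ℝ (Fin n) → ℝ)
    (hu : ContDiffOn ℝ (⊤ : ℕ∞) u U) (hv : ContDiffOn ℝ (⊤ : ℕ∞) v U)
    (hpde : ∀ x ∈ U, |lap u x| ≤ C * (|u x| + ‖gradient u x‖ + |v x|))
    (hode : ∀ x ∈ U, |fderiv ℝ v x x| ≤ C * (|v x| + |u x| + ‖gradient u x‖))
    (hu0 : ∀ k : ℕ, iteratedFDeriv ℝ k u 0 = 0)
    (hv0 : ∀ k : ℕ, iteratedFDeriv ℝ k v 0 = 0) :
    ∃ W : Set (EuclideanSpace ℝ (Fin n)), IsOpen W ∧ (0 : EuclideanSpace ℝ (Fin n)) ∈ W ∧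
      ∀ x ∈ W, u x = 0 ∧ v x = 0 := by
  have : NeZero n := ⟨by lia⟩
  obtain ⟨R, hR, hRU⟩ := nhds_basis_closedBall.mem_iff.1 (hU.mem_nhds h0U)
  let χ : ContDiffBump (0 : EuclideanSpace ℝ (Fin n)) := ⟨R / 2, R, by linarith, by linarith⟩
  obtain ⟨hfu, hequ⟩ := exists_isFlat_eqOn hU hu hu0 χ hRU
  obtain ⟨hfv, heqv⟩ := exists_isFlat_eqOn hU hv hv0 χ hRU
  have hr : 0 < min (R / 4) (1 / 4) := by positivity
  have hsub : ∀ x ∈ closedBall (0 : EuclideanSpace ℝ (Fin n)) (min (R / 4) (1 / 4)),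
      x ∈ ball (0 : EuclideanSpace ℝ (Fin n)) (R / 2) ∧ x ∈ U := fun x hx => by
    have hx' := (mem_closedBall.1 hx).trans (min_le_left _ _)
    exact ⟨mem_ball.2 (by linarith), hRU (mem_closedBall.2 (by linarith))⟩
  refine ⟨ball 0 (min (R / 4) (1 / 4) / 8), isOpen_ball, mem_ball_self (by positivity),
    fun x hx => ?_⟩
  have key := hfu.eq_zero_of_abs_lap_le hC hfv hr (min_le_right _ _) (fun y hy => ?_)
    (fun y hy => ?_) x hx
  · have hx' := (hsub x (ball_subset_closedBall (ball_subset_ball (by linarith) hx))).1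
    rwa [(hequ x hx').eq_of_nhds, (heqv x hx').eq_of_nhds] at key
  · have hy' := hsub y hy
    have h := hpde y hy'.2
    have hu' := hequ y hy'.1
    rwa [lap, (hu'.iteratedFDeriv ℝ 2).eq_of_nhds, ← lap, hu'.eq_of_nhds,
      (heqv y hy'.1).eq_of_nhds, gradient, hu'.fderiv_eq]
  · have hy' := hsub y hy
    have h := hode y hy'.2
    have hu' := hequ y hy'.1
    have hv' := heqv y hy'.1
    rwa [hv'.fderiv_eq, hu'.eq_of_nhds, hv'.eq_of_nhds, gradient, hu'.fderiv_eq]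
end

section
/- Let n ≥ 1 be an integer and C ≥ 0. Suppose v is a smooth real-valued function on an open neighborhood of the origin in ℝⁿ satisfying |⟨x, ∇v(x)⟩| ≤ C |v(x)| on that neighborhood, where ⟨x, ∇v(x)⟩ is the derivative of v along the radial vector field r∂_r. If v vanishes to infinite order at the origin, then v ≡ 0 on some open neighborhood of the origin. -/
open MeasureTheory Metric Filter Topology Set

/-- If `f` satisfies the Euler-type inequality `|t f'(t)| ≤ K |f t|` on `(0, 1]`, then
`f t ^ 2 / t ^ (2 * K)` is nonincreasing there. -/
theorem sq_div_pow_antitoneOn_of_abs_mul_deriv_le {f f' : ℝ → ℝ} {K : ℕ}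
    (hf : ∀ t ∈ Ioc (0 : ℝ) 1, HasDerivAt f (f' t) t)
    (hK : ∀ t ∈ Ioc (0 : ℝ) 1, |t * f' t| ≤ K * |f t|) :
    AntitoneOn (fun t => f t ^ 2 / t ^ (2 * K)) (Ioc 0 1) := by
  have hd : ∀ t ∈ Ioc (0 : ℝ) 1, HasDerivAt (fun t => f t ^ 2 / t ^ (2 * K))
      ((2 * f t * f' t * t ^ (2 * K) - f t ^ 2 * (2 * K * t ^ (2 * K - 1))) / (t ^ (2 * K)) ^ 2)
      t := by
    intro t ht
    convert! ((hf t ht).pow 2).div (hasDerivAt_pow (2 * K) t) (pow_ne_zero _ ht.1.ne') using 1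
    simp
  refine antitoneOn_of_hasDerivWithinAt_nonpos (convex_Ioc 0 1)
    (fun t ht => (hd t ht).continuousAt.continuousWithinAt)
    (fun t ht => (hd t (interior_subset ht)).hasDerivWithinAt) fun t ht => ?_
  replace ht := interior_subset ht
  have ht0 := ht.1
  refine div_nonpos_of_nonpos_of_nonneg ?_ (by positivity)
  have hmul : t * f t * f' t ≤ K * f t ^ 2 := by
    calc t * f t * f' t ≤ |f t * (t * f' t)| := by
          rw [show t * f t * f' t = f t * (t * f' t) by ring]; exact le_abs_self _
      _ = |f t| * |t * f' t| := abs_mul _ _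
      _ ≤ |f t| * (K * |f t|) := by gcongr; exact hK t ht
      _ = K * f t ^ 2 := by rw [← sq_abs (f t)]; ring
  refine nonpos_of_mul_nonpos_right (a := t) ?_ ht0
  have hpow : (K : ℝ) * t ^ (2 * K - 1) * t = K * t ^ (2 * K) := by
    rcases K.eq_zero_or_pos with rfl | h
    · simp
    · rw [mul_assoc, pow_sub_one_mul (by omega)]
  calc t * (2 * f t * f' t * t ^ (2 * K) - f t ^ 2 * (2 * K * t ^ (2 * K - 1)))
      = 2 * t ^ (2 * K) * (t * f t * f' t) - 2 * f t ^ 2 * (K * t ^ (2 * K - 1) * t) := by ring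
    _ = 2 * t ^ (2 * K) * (t * f t * f' t - K * f t ^ 2) := by rw [hpow]; ring
    _ ≤ 0 := mul_nonpos_of_nonneg_of_nonpos (by positivity) (by linarith)

/-- A function satisfying `|t f'(t)| ≤ K |f t|` on `(0, 1]` and `f t = o(t ^ K)` at `0`
vanishes at `1`. -/
theorem eq_zero_of_abs_mul_deriv_le_of_isLittleO {f f' : ℝ → ℝ} {K : ℕ}
    (hf : ∀ t ∈ Ioc (0 : ℝ) 1, HasDerivAt f (f' t) t)
    (hK : ∀ t ∈ Ioc (0 : ℝ) 1, |t * f' t| ≤ K * |f t|)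
    (ho : f =o[𝓝[>] 0] fun t => t ^ K) : f 1 = 0 := by
  have hanti := sq_div_pow_antitoneOn_of_abs_mul_deriv_le hf hK
  have hlim : Tendsto (fun t => f t ^ 2 / t ^ (2 * K)) (𝓝[>] 0) (𝓝 0) := by
    simpa [div_pow, ← pow_mul, mul_comm K] using ho.tendsto_div_nhds_zero.pow 2
  have h : f 1 ^ 2 ≤ 0 := by
    refine ge_of_tendsto hlim ?_
    filter_upwards [Ioc_mem_nhdsGT one_pos] with t ht
    simpa using hanti ht (right_mem_Ioc.2 one_pos) ht.2
  exact pow_eq_zero_iff two_ne_zero |>.1 (le_antisymm h (sq_nonneg _))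

/-- A smooth function that vanishes to infinite order at the origin is `o(t ^ N)` along every
line through the origin. -/
theorem isLittleO_smul_of_iteratedFDeriv_eq_zero {E : Type*} [NormedAddCommGroup E]
    [NormedSpace ℝ E] {U : Set E} (hU : IsOpen U) (h0 : (0 : E) ∈ U) (hconv : Convex ℝ U)
    {v : E → ℝ} {N : ℕ} (hv : ContDiffOn ℝ N v U) (hv0 : ∀ k : ℕ, iteratedFDeriv ℝ k v 0 = 0)
    (x : E) : (fun t : ℝ => v (t • x)) =o[𝓝 0] fun t => t ^ N := by
  let L : ℝ →L[ℝ] E := ContinuousLinearMap.toSpanSingleton ℝ x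
  have hs : IsOpen (L ⁻¹' U) := hU.preimage L.continuous
  have h0s : (0 : ℝ) ∈ L ⁻¹' U := by simpa using h0
  have hsconv : Convex ℝ (L ⁻¹' U) := hconv.linear_preimage L.toLinearMap
  have hderiv : ∀ k ≤ N, iteratedDerivWithin k (v ∘ L) (L ⁻¹' U) 0 = 0 := by
    intro k hk
    rw [iteratedDerivWithin_eq_iteratedFDerivWithin,
      L.iteratedFDerivWithin_comp_right hv hU.uniqueDiffOn hs.uniqueDiffOn h0s
        (by exact_mod_cast hk), map_zero, iteratedFDerivWithin_of_isOpen k hU h0, hv0]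
    simp
  have htaylor : ∀ t, taylorWithinEval (v ∘ L) N (L ⁻¹' U) 0 t = 0 := by
    intro t
    rw [taylor_within_apply]
    refine Finset.sum_eq_zero fun k hk => ?_
    rw [hderiv k (Nat.lt_succ_iff.1 (Finset.mem_range.1 hk)), smul_zero]
  have := taylor_isLittleO hsconv h0s (hv.comp L.contDiff.contDiffOn (mapsTo_preimage _ _))
  simp only [hs.nhdsWithin_eq h0s, htaylor, sub_zero] at this
  exact this

/-- Strong unique continuation for the pure ODE case: if a smooth function `v` on a
neighborhood of the origin satisfies `|⟨x, ∇v(x)⟩| ≤ C |v(x)|`, where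
`⟨x, ∇v(x)⟩ = (Dv)(x)(x)` is the derivative of `v` along the radial vector field
`r ∂_r`, and `v` vanishes to infinite order at the origin, then `v ≡ 0` on some
neighborhood of the origin. -/
theorem sucp_radial_ode (n : ℕ) (hn : 1 ≤ n) (C : ℝ) (hC : 0 ≤ C)
    (U : Set (EuclideanSpace ℝ (Fin n))) (hU : IsOpen U) (h0U : (0 : EuclideanSpace ℝ (Fin n)) ∈ U)
    (v : EuclideanSpace ℝ (Fin n) → ℝ) (hv : ContDiffOn ℝ (⊤ : ℕ∞) v U)
    (hode : ∀ x ∈ U, |fderiv ℝ v x x| ≤ C * |v x|)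
    (hv0 : ∀ k : ℕ, iteratedFDeriv ℝ k v 0 = 0) :
    ∃ W : Set (EuclideanSpace ℝ (Fin n)), IsOpen W ∧ (0 : EuclideanSpace ℝ (Fin n)) ∈ W ∧
      ∀ x ∈ W, v x = 0 := by
  obtain ⟨r, hr, hball⟩ := Metric.isOpen_iff.1 hU 0 h0U
  refine ⟨ball 0 r, isOpen_ball, mem_ball_self hr, fun x hx => ?_⟩
  obtain ⟨K, hCK⟩ := exists_nat_ge C
  have hmem : ∀ t ∈ Ioc (0 : ℝ) 1, t • x ∈ U := fun t ht =>
    hball ((convex_ball 0 r).smul_mem_of_zero_mem (mem_ball_self hr) hx ⟨ht.1.le, ht.2⟩)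
  have ho := isLittleO_smul_of_iteratedFDeriv_eq_zero (N := K) isOpen_ball (mem_ball_self hr)
    (convex_ball 0 r) ((hv.mono hball).of_le (by exact_mod_cast le_top)) hv0 x
  have h1 := eq_zero_of_abs_mul_deriv_le_of_isLittleO (f := fun t : ℝ => v (t • x))
    (f' := fun t => fderiv ℝ v (t • x) x) (K := K) (fun t ht => ?_) (fun t ht => ?_)
    (ho.mono nhdsWithin_le_nhds)
  · simpa using h1
  · have hvt : DifferentiableAt ℝ v (t • x) :=
      (hv.contDiffAt (hU.mem_nhds (hmem t ht))).differentiableAt (by simp)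
    have hline : HasDerivAt (fun t : ℝ => t • x) x t := by
      simpa using (hasDerivAt_id t).smul_const x
    exact hvt.hasFDerivAt.comp_hasDerivAt t hline
  · have h := hode _ (hmem t ht)
    rw [map_smul, smul_eq_mul] at h
    exact h.trans (by gcongr)
end
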